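/- arXiv:2602.08555 — 3 statements merged into one kernel-verified Lean document; each statement's English description precedes it below -/
import Mathlib

section
/- Let 1 < q < ∞. There exists a constant C > 0 (depending only on q) such that for every ε > 0 and every continuously differentiable vector field v : ℝ³ → ℝ³ with compact support, one has the rescaled Korn inequality ‖D_ε v‖_{L^q(ℝ³)} ≤ C ‖𝔻_ε[v]‖_{L^q(ℝ³)}; in particular the constant C does not depend on ε. -/
open MeasureTheory

/-- The rescaled gradient `D_ε v` of a vector field `v : ℝ³ → ℝ³`:
`(D_ε v)_{ij} = ∂_{x_j} v_i` for `j = 0,1` and `(D_ε v)_{i2} = ε⁻¹ ∂_{x₂} v_i`. -/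
noncomputable def Deps (ε : ℝ) (v : (Fin 3 → ℝ) → (Fin 3 → ℝ)) (x : Fin 3 → ℝ) :
    Matrix (Fin 3) (Fin 3) ℝ :=
  fun i j => (if j = 2 then ε⁻¹ else 1) * fderiv ℝ v x (Pi.single j 1) i

/-- The rescaled symmetric gradient `𝔻_ε[v] = (D_ε v + (D_ε v)ᵀ)/2`. -/
noncomputable def symDeps (ε : ℝ) (v : (Fin 3 → ℝ) → (Fin 3 → ℝ)) (x : Fin 3 → ℝ) :
    Matrix (Fin 3) (Fin 3) ℝ :=
  fun i j => (Deps ε v x i j + Deps ε v x j i) / 2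

section ScalarInequalities

theorem sq_rpow_half (x p : ℝ) : (x ^ 2) ^ (p / 2) = |x| ^ p := by
  rw [← sq_abs, ← Real.rpow_natCast, ← Real.rpow_mul (abs_nonneg x)]
  congr 1
  push_cast
  ring

theorem abs_add_rpow_add_abs_sub_rpow (x h p : ℝ) :
    |x + h| ^ p + |x - h| ^ p = (|x| + |h|) ^ p + |(|x| - |h|)| ^ p := by
  rcases le_total 0 x with hx | hx <;> rcases le_total 0 h with hh | hh
  · rw [abs_of_nonneg hx, abs_of_nonneg hh, abs_of_nonneg (add_nonneg hx hh)]
  · rw [abs_of_nonneg hx, abs_of_nonpos hh, abs_of_nonneg (by linarith : 0 ≤ x - h), add_comm,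
      sub_neg_eq_add, sub_eq_add_neg]
  · rw [abs_of_nonpos hx, abs_of_nonneg hh, abs_of_nonpos (by linarith : x - h ≤ 0), add_comm,
      ← abs_neg (x + h)]
    ring_nf
  · rw [abs_of_nonpos hx, abs_of_nonpos hh, abs_of_nonpos (by linarith : x + h ≤ 0),
      ← abs_neg (x - h)]
    ring_nf

theorem second_diff_rpow_ge {p : ℝ} (hp : 2 ≤ p) (x h : ℝ) :
    2 * (h ^ 2 * (x ^ 2 + h ^ 2) ^ (p / 2 - 1)) ≤ |x + h| ^ p + |x - h| ^ p - 2 * |x| ^ p := by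
  have hx := sq_nonneg x
  have hh := sq_nonneg h
  have jensen := (convexOn_rpow (by linarith : 1 ≤ p / 2)).2 (sq_nonneg (x + h))
    (sq_nonneg (x - h)) (by norm_num : (0 : ℝ) ≤ 1 / 2) (by norm_num : (0 : ℝ) ≤ 1 / 2) (by norm_num)
  simp only [smul_eq_mul, sq_rpow_half] at jensen
  rw [show 1 / 2 * (x + h) ^ 2 + 1 / 2 * (x - h) ^ 2 = x ^ 2 + h ^ 2 by ring] at jensen
  have split (u : ℝ) (hu : 0 ≤ u) : u ^ (p / 2) = u * u ^ (p / 2 - 1) := by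
    rw [mul_comm, ← Real.rpow_add_one' hu (by linarith)]
    ring_nf
  have mono : (x ^ 2) ^ (p / 2 - 1) ≤ (x ^ 2 + h ^ 2) ^ (p / 2 - 1) :=
    Real.rpow_le_rpow hx (by linarith) (by linarith)
  rw [split _ (by positivity)] at jensen
  rw [← sq_rpow_half x, split _ hx]
  nlinarith [mul_le_mul_of_nonneg_left mono hx]

theorem two_mul_abs_rpow_le_second_diff {p : ℝ} (hp : 2 ≤ p) (x h : ℝ) :
    2 * |h| ^ p ≤ |x + h| ^ p + |x - h| ^ p - 2 * |x| ^ p := by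
  refine le_trans ?_ (second_diff_rpow_ge hp x h)
  have hh := sq_nonneg h
  have mono : (h ^ 2) ^ (p / 2 - 1) ≤ (x ^ 2 + h ^ 2) ^ (p / 2 - 1) :=
    Real.rpow_le_rpow hh (by nlinarith) (by linarith)
  have split : (h ^ 2) ^ (p / 2) = h ^ 2 * (h ^ 2) ^ (p / 2 - 1) := by
    rw [mul_comm, ← Real.rpow_add_one' hh (by linarith)]
    ring_nf
  rw [← sq_rpow_half, split]
  nlinarith [mul_le_mul_of_nonneg_left mono hh]

theorem two_mul_sq_mul_abs_rpow_le_second_diff {p : ℝ} (hp : 2 ≤ p) (x h : ℝ) :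
    2 * (h ^ 2 * |x| ^ (p - 2)) ≤ |x + h| ^ p + |x - h| ^ p - 2 * |x| ^ p := by
  refine le_trans ?_ (second_diff_rpow_ge hp x h)
  rw [← sq_rpow_half, show (p - 2) / 2 = p / 2 - 1 by ring]
  gcongr
  · linarith
  · nlinarith [sq_nonneg h]

theorem sq_le_one_add_rpow_add_one_sub_rpow {q t : ℝ} (hq : 1 < q) (hq2 : q ≤ 2)
    (ht : 0 ≤ t) (ht1 : t ≤ 1) :
    2 + (q - 1) ^ 2 * t ^ 2 ≤ (1 + t) ^ q + (1 - t) ^ q := by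
  have h1 : 1 + q * t ≤ (1 + t) ^ q := one_add_mul_self_le_rpow_one_add (by linarith) hq.le
  suffices h2 : 1 - q * t + (q - 1) ^ 2 * t ^ 2 ≤ (1 - t) ^ q by linarith
  rcases ht1.eq_or_lt with rfl | ht1
  · rw [sub_self, Real.zero_rpow (by linarith)]
    nlinarith
  have hb : (1 + -t) ^ (2 - q) ≤ 1 + (2 - q) * -t :=
    rpow_one_add_le_one_add_mul_self (by linarith) (by linarith) (by linarith)
  rw [← sub_eq_add_neg] at hb
  have hpos : 0 < 1 - t := by linarith
  have hmul : (1 - t) ^ q * (1 - t) ^ (2 - q) = (1 - t) ^ 2 := by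
    rw [← Real.rpow_add hpos, ← Real.rpow_natCast]
    congr 1
    push_cast
    ring
  have hX : 0 ≤ (1 - t) ^ q := Real.rpow_nonneg hpos.le q
  have hden : 0 < 1 - (2 - q) * t := by nlinarith
  refine le_of_mul_le_mul_right ?_ hden
  calc (1 - q * t + (q - 1) ^ 2 * t ^ 2) * (1 - (2 - q) * t)
      ≤ (1 - t) ^ 2 := by
        nlinarith [mul_nonneg (mul_nonneg (sq_nonneg (q - 1)) (sq_nonneg t))
          (mul_nonneg (sub_nonneg.2 hq2) ht)]
    _ ≤ (1 - t) ^ q * (1 - (2 - q) * t) := by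
        rw [← hmul]
        nlinarith [mul_le_mul_of_nonneg_left hb hX]

theorem second_diff_rpow_ge_of_abs_le {q : ℝ} (hq : 1 < q) (hq2 : q ≤ 2) {y k : ℝ}
    (hy : y ≠ 0) (hk : |k| ≤ |y|) :
    (q - 1) ^ 2 * (k ^ 2 * |y| ^ (q - 2)) ≤ |y + k| ^ q + |y - k| ^ q - 2 * |y| ^ q := by
  have hY : 0 < |y| := abs_pos.2 hy
  rw [abs_add_rpow_add_abs_sub_rpow, abs_of_nonneg (sub_nonneg.2 hk), ← sq_abs k]
  set Y := |y|
  set K := |k|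
  have hK : 0 ≤ K := abs_nonneg k
  have key := sq_le_one_add_rpow_add_one_sub_rpow hq hq2 (t := K / Y) (by positivity)
    ((div_le_one hY).2 hk)
  have e1 : (Y + K) ^ q = Y ^ q * (1 + K / Y) ^ q := by
    rw [← Real.mul_rpow hY.le (by positivity)]
    congr 1
    field_simp
  have e2 : (Y - K) ^ q = Y ^ q * (1 - K / Y) ^ q := by
    rw [← Real.mul_rpow hY.le (sub_nonneg.2 ((div_le_one hY).2 hk))]
    congr 1
    field_simp
  have e3 : K ^ 2 * Y ^ (q - 2) = Y ^ q * (K / Y) ^ 2 := by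
    rw [Real.rpow_sub hY, Real.rpow_two]
    field_simp
  rw [e1, e2, e3]
  nlinarith [mul_le_mul_of_nonneg_left key (Real.rpow_nonneg hY.le q)]

theorem second_diff_rpow_ge_of_le_abs {q : ℝ} (hq : 1 < q) (hq2 : q ≤ 2) {y k : ℝ}
    (hk : |y| ≤ |k|) :
    (q - 1) ^ 2 * |k| ^ q ≤ |y + k| ^ q + |y - k| ^ q - 2 * |y| ^ q := by
  rcases (abs_nonneg k).eq_or_lt with h0 | hK
  · have hy0 : y = 0 := abs_nonpos_iff.1 (h0 ▸ hk)
    have hk0 : k = 0 := abs_eq_zero.1 h0.symm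
    simp [hy0, hk0, Real.zero_rpow (by linarith : q ≠ 0)]
  rw [abs_add_rpow_add_abs_sub_rpow, abs_sub_comm, abs_of_nonneg (sub_nonneg.2 hk), add_comm |y|]
  set Y := |y|
  set K := |k|
  have hY : 0 ≤ Y := abs_nonneg y
  have hs1 : Y / K ≤ 1 := (div_le_one hK).2 hk
  have hs0 : 0 ≤ Y / K := by positivity
  have key := sq_le_one_add_rpow_add_one_sub_rpow hq hq2 hs0 hs1
  have e1 : (K + Y) ^ q = K ^ q * (1 + Y / K) ^ q := by
    rw [← Real.mul_rpow hK.le (by positivity)]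
    congr 1
    field_simp
  have e2 : (K - Y) ^ q = K ^ q * (1 - Y / K) ^ q := by
    rw [← Real.mul_rpow hK.le (sub_nonneg.2 hs1)]
    congr 1
    field_simp
  have e3 : Y ^ q = K ^ q * (Y / K) ^ q := by
    rw [← Real.mul_rpow hK.le hs0]
    congr 1
    field_simp
  have e4 : (Y / K) ^ q ≤ Y / K := by
    simpa using Real.rpow_le_rpow_of_exponent_ge_of_imp hs0 hs1 hq.le (by intros; linarith)
  have key2 : (q - 1) ^ 2 ≤ (1 + Y / K) ^ q + (1 - Y / K) ^ q - 2 * (Y / K) ^ q := by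
    set s := Y / K
    have ha : (q - 1) ^ 2 ≤ 1 := by nlinarith
    nlinarith [mul_nonneg (sub_nonneg.2 ha) (sub_nonneg.2 hs1), 
      mul_nonneg (mul_nonneg (sub_nonneg.2 ha) (sub_nonneg.2 hs1)) hs0, sq_nonneg (1 - s)]
  rw [e1, e2, e3]
  nlinarith [mul_le_mul_of_nonneg_left key2 (Real.rpow_nonneg hK.le q)]

theorem abs_rpow_le_second_diff_of_abs_le_two_mul {q : ℝ} (hq : 1 < q) (hq2 : q ≤ 2) {y k : ℝ}
    (hk : |y| ≤ 2 * |k|) :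
    (q - 1) ^ 2 / 2 * |k| ^ q ≤ |y + k| ^ q + |y - k| ^ q - 2 * |y| ^ q := by
  rcases le_total |y| |k| with h | h
  · refine le_trans ?_ (second_diff_rpow_ge_of_le_abs hq hq2 h)
    have := Real.rpow_nonneg (abs_nonneg k) q
    nlinarith [mul_nonneg (sq_nonneg (q - 1)) this]
  rcases (abs_nonneg k).eq_or_lt with h0 | hK
  · have hy0 : y = 0 := abs_nonpos_iff.1 (by linarith)
    have hk0 : k = 0 := abs_eq_zero.1 h0.symm
    simp [hy0, hk0, Real.zero_rpow (by linarith : q ≠ 0)]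
  have hY : 0 < |y| := hK.trans_le h
  refine le_trans ?_ (second_diff_rpow_ge_of_abs_le hq hq2 (abs_pos.1 hY) h)
  have e1 : (2 * |k|) ^ (q - 2) ≤ |y| ^ (q - 2) :=
    Real.rpow_le_rpow_of_nonpos hY hk (by linarith)
  have e2 : (2 : ℝ)⁻¹ ≤ 2 ^ (q - 2) := by
    rw [← Real.rpow_neg_one]
    exact Real.rpow_le_rpow_of_exponent_le (by norm_num) (by linarith)
  have e3 : |k| ^ q = k ^ 2 * |k| ^ (q - 2) := by
    rw [Real.rpow_sub hK, Real.rpow_two, ← sq_abs k]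
    field_simp
  rw [Real.mul_rpow (by norm_num) hK.le] at e1
  have e4 : 2⁻¹ * |k| ^ (q - 2) ≤ |y| ^ (q - 2) :=
    (mul_le_mul_of_nonneg_right e2 (Real.rpow_nonneg hK.le _)).trans e1
  rw [e3]
  linarith [mul_le_mul_of_nonneg_left e4 (mul_nonneg (sq_nonneg (q - 1)) (sq_nonneg k))]

/-- A lower Taylor bound for the concave power `(1 + t) ^ s`. -/
theorem one_add_mul_sub_sq_le_rpow {s t : ℝ} (hs : 0 ≤ s) (hs1 : s ≤ 1) (ht : |t| ≤ 1 / 2) :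
    1 + s * t - t ^ 2 ≤ (1 + t) ^ s := by
  obtain ⟨ht1, ht2⟩ := abs_le.1 ht
  have hpos : 0 < 1 + t := by linarith
  have hb : (1 + t) ^ (1 - s) ≤ 1 + (1 - s) * t :=
    rpow_one_add_le_one_add_mul_self (by linarith) (by linarith) (by linarith)
  have hmul : (1 + t) ^ s * (1 + t) ^ (1 - s) = 1 + t := by
    rw [← Real.rpow_add hpos]
    simp
  have hX : 0 ≤ (1 + t) ^ s := Real.rpow_nonneg hpos.le s
  have hden : 1 / 2 ≤ 1 + (1 - s) * t := by nlinarith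
  refine le_of_mul_le_mul_right ?_ (by linarith : 0 < 1 + (1 - s) * t)
  calc (1 + s * t - t ^ 2) * (1 + (1 - s) * t) ≤ 1 + t := by
        nlinarith [mul_le_mul_of_nonneg_left hden (sq_nonneg t),
          mul_nonneg (sq_nonneg t) (sq_nonneg (s - 1 / 2))]
    _ ≤ (1 + t) ^ s * (1 + (1 - s) * t) := by
        nlinarith [mul_le_mul_of_nonneg_left hb hX]

theorem second_diff_sq_mul_rpow_ge {s x h y k : ℝ} (hs : 0 ≤ s) (hs1 : s ≤ 1) (hy : 0 < y)
    (hk : |k| ≤ y / 2) (hx : x ^ 2 ≤ y ^ (2 - 2 * s)) :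
    h ^ 2 * y ^ s / 2 - 20 * (k ^ 2 * y ^ (-s)) ≤
      (x + h) ^ 2 * (y + k) ^ s + (x - h) ^ 2 * (y - k) ^ s - 2 * (x ^ 2 * y ^ s) := by
  set t := k / y with ht_def
  have ht : |t| ≤ 1 / 2 := by
    rw [ht_def, abs_div, abs_of_pos hy, div_le_iff₀ hy]
    linarith
  have hkt : k = y * t := by
    rw [ht_def]
    field_simp
  obtain ⟨ht1, ht2⟩ := abs_le.1 ht
  have hY : 0 < y ^ s := Real.rpow_pos_of_pos hy s
  have e1 : (y + k) ^ s = y ^ s * (1 + t) ^ s := by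
    rw [← Real.mul_rpow hy.le (by linarith), hkt]
    ring_nf
  have e2 : (y - k) ^ s = y ^ s * (1 - t) ^ s := by
    rw [← Real.mul_rpow hy.le (by linarith), hkt]
    ring_nf
  have e3 : x ^ 2 * t ^ 2 * y ^ s ≤ k ^ 2 * y ^ (-s) := by
    have : y ^ (2 - 2 * s) * y ^ s = y ^ 2 * y ^ (-s) := by
      rw [← Real.rpow_natCast, ← Real.rpow_add hy, ← Real.rpow_add hy]
      congr 1
      push_cast
      ring
    calc x ^ 2 * t ^ 2 * y ^ s = x ^ 2 * (t ^ 2 * y ^ s) := by ring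
      _ ≤ y ^ (2 - 2 * s) * (t ^ 2 * y ^ s) := by gcongr
      _ = t ^ 2 * (y ^ (2 - 2 * s) * y ^ s) := by ring
      _ = k ^ 2 * y ^ (-s) := by rw [this, hkt]; ring
  have l1 := one_add_mul_sub_sq_le_rpow hs hs1 ht
  have l2 := one_add_mul_sub_sq_le_rpow (t := -t) hs hs1 (by rwa [abs_neg])
  have u1 : (1 + t) ^ s ≤ 1 + s * t :=
    rpow_one_add_le_one_add_mul_self (by linarith) hs hs1
  have u2 : (1 + -t) ^ s ≤ 1 + s * -t :=
    rpow_one_add_le_one_add_mul_self (by linarith) hs hs1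
  rw [← sub_eq_add_neg] at l2 u2
  rw [e1, e2]
  set u := (1 + t) ^ s
  set w := (1 - t) ^ s
  have hsum : 2 - 2 * t ^ 2 ≤ u + w := by linarith
  have ht4 : t ^ 2 ≤ 1 / 4 := by nlinarith
  have hst : (s * t) ^ 2 ≤ t ^ 2 := by
    have : s ^ 2 ≤ 1 := by nlinarith
    nlinarith [mul_le_mul_of_nonneg_right this (sq_nonneg t)]
  have hdiff : (u - w) ^ 2 ≤ 9 * t ^ 2 := by
    have a1 : |u - w| ≤ 2 * |s * t| + t ^ 2 := by
      rw [abs_le]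
      constructor <;> linarith [le_abs_self (s * t), neg_abs_le (s * t)]
    have a2 : |s * t| ≤ |t| := sq_le_sq.1 hst
    have a3 : |u - w| ≤ 3 * |t| := by nlinarith [sq_abs t, abs_nonneg t]
    calc (u - w) ^ 2 = |u - w| ^ 2 := (sq_abs _).symm
      _ ≤ (3 * |t|) ^ 2 := by gcongr
      _ = 9 * t ^ 2 := by rw [mul_pow, sq_abs]; norm_num
  have core : h ^ 2 / 2 - 20 * (x ^ 2 * t ^ 2) ≤
      (x + h) ^ 2 * u + (x - h) ^ 2 * w - 2 * x ^ 2 := by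
    have cross : -(h ^ 2 / 2 + 18 * (x ^ 2 * t ^ 2)) ≤ 2 * x * h * (u - w) := by
      linarith [sq_nonneg (h + 2 * x * (u - w)), mul_le_mul_of_nonneg_left hdiff (sq_nonneg x)]
    linarith [mul_le_mul_of_nonneg_left hsum (sq_nonneg x),
      mul_le_mul_of_nonneg_left hsum (sq_nonneg h), mul_le_mul_of_nonneg_left ht4 (sq_nonneg h),
      sq_nonneg h, mul_nonneg (sq_nonneg x) (sq_nonneg t)]
  linarith [mul_le_mul_of_nonneg_left core hY.le]

theorem second_diff_sq_mul_abs_rpow_ge {s x h y k : ℝ} (hs : 0 ≤ s) (hs1 : s ≤ 1) (hy : y ≠ 0)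
    (hk : |k| ≤ |y| / 2) (hx : x ^ 2 ≤ |y| ^ (2 - 2 * s)) :
    h ^ 2 * |y| ^ s / 2 - 20 * (k ^ 2 * |y| ^ (-s)) ≤
      (x + h) ^ 2 * |y + k| ^ s + (x - h) ^ 2 * |y - k| ^ s - 2 * (x ^ 2 * |y| ^ s) := by
  rcases hy.lt_or_gt with hy | hy
  · have hy' : |y| = -y := abs_of_neg hy
    rw [hy'] at hk hx ⊢
    obtain ⟨h1, h2⟩ := abs_le.1 hk
    rw [abs_of_neg (by linarith : y + k < 0), abs_of_neg (by linarith : y - k < 0)]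
    have := second_diff_sq_mul_rpow_ge (h := h) (k := -k) hs hs1 (by linarith : 0 < -y)
      (by rwa [abs_neg]) hx
    rw [neg_sq] at this
    convert this using 6 <;> ring
  · have hy' : |y| = y := abs_of_pos hy
    rw [hy'] at hk hx ⊢
    obtain ⟨h1, h2⟩ := abs_le.1 hk
    rw [abs_of_pos (by linarith : 0 < y + k), abs_of_pos (by linarith : 0 < y - k)]
    exact second_diff_sq_mul_rpow_ge hs hs1 hy hk hx

end ScalarInequalities

section Bellman

/-- A function `B` which is comparable to `|x| ^ p + |y| ^ q` from above and strictly biconvex, in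
the sense that its second differences dominate the product of the two increments. -/
structure IsBellman (p q c : ℝ) (B : ℝ → ℝ → ℝ) : Prop where
  pos : 0 < c
  continuous : Continuous fun z : ℝ × ℝ => B z.1 z.2
  nonneg : ∀ x y, 0 ≤ B x y
  le : ∀ x y, B x y ≤ 2 * (|x| ^ p + |y| ^ q)
  second_diff : ∀ x y h k, c * (|h| * |k|) ≤ B (x + h) (y + k) + B (x - h) (y - k) - 2 * B x y

theorem IsBellman.swap {p q c : ℝ} {B : ℝ → ℝ → ℝ} (hB : IsBellman p q c B) :
    IsBellman q p c fun x y => B y x where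
  pos := hB.pos
  continuous := hB.continuous.comp continuous_swap
  nonneg x y := hB.nonneg y x
  le x y := (hB.le y x).trans_eq (by ring)
  second_diff x y h k := by simpa [mul_comm |h|] using hB.second_diff y x k h

variable {p q : ℝ}

theorem sq_mul_abs_rpow_le (hpq : p.HolderConjugate q) (hp : 2 ≤ p) (x y : ℝ) :
    x ^ 2 * |y| ^ (2 - q) ≤ |x| ^ p + |y| ^ q := by
  have hp0 : 0 < p := by linarith
  have hX : 0 ≤ |x| ^ p := Real.rpow_nonneg (abs_nonneg x) p
  have hY : 0 ≤ |y| ^ q := Real.rpow_nonneg (abs_nonneg y) q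
  have h2p : 2 / p ≤ 1 := (div_le_one hp0).2 hp
  have key := Real.geom_mean_le_arith_mean2_weighted (by positivity : 0 ≤ 2 / p)
    (by linarith : 0 ≤ 1 - 2 / p) hX hY (by ring)
  have hqp := hpq.symm.div_conj_eq_sub_one
  rw [← Real.rpow_mul (abs_nonneg x), ← Real.rpow_mul (abs_nonneg y),
    mul_div_cancel₀ _ hp0.ne', show q * (1 - 2 / p) = 2 - q by linear_combination -2 * hqp,
    Real.rpow_two, sq_abs] at key
  refine key.trans (add_le_add (mul_le_of_le_one_left hX h2p) (mul_le_of_le_one_left hY ?_))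
  have : 0 ≤ 2 / p := by positivity
  linarith

theorem abs_rpow_two_sub_le (hpq : p.HolderConjugate q) (hp : 2 ≤ p) {x y : ℝ}
    (h : |y| ^ q ≤ 3 * |x| ^ p) : |y| ^ (2 - q) ≤ 3 * |x| ^ (p - 2) := by
  have hp0 : 0 < p := by linarith
  have h2p : 2 / p ≤ 1 := (div_le_one hp0).2 hp
  have h2p' : 0 ≤ 2 / p := by positivity
  have hqp := hpq.symm.div_conj_eq_sub_one
  have key := Real.rpow_le_rpow (Real.rpow_nonneg (abs_nonneg y) q) h (by linarith : 0 ≤ 1 - 2 / p)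
  rw [Real.mul_rpow (by norm_num) (Real.rpow_nonneg (abs_nonneg x) p),
    ← Real.rpow_mul (abs_nonneg x), ← Real.rpow_mul (abs_nonneg y),
    show q * (1 - 2 / p) = 2 - q by linear_combination -2 * hqp,
    show p * (1 - 2 / p) = p - 2 by field_simp] at key
  refine key.trans (mul_le_mul_of_nonneg_right ?_ (Real.rpow_nonneg (abs_nonneg x) _))
  simpa using Real.rpow_le_rpow_of_exponent_le (by norm_num : (1 : ℝ) ≤ 3)
    (by linarith : 1 - 2 / p ≤ 1)

theorem sq_le_abs_rpow (hpq : p.HolderConjugate q) (hp : 2 ≤ p) {x y : ℝ}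
    (h : |x| ^ p ≤ |y| ^ q) : x ^ 2 ≤ |y| ^ (2 - 2 * (2 - q)) := by
  have hp0 : 0 < p := by linarith
  have hqp := hpq.symm.div_conj_eq_sub_one
  have key := Real.rpow_le_rpow (Real.rpow_nonneg (abs_nonneg x) p) h
    (by positivity : 0 ≤ 2 / p)
  rwa [← Real.rpow_mul (abs_nonneg x), ← Real.rpow_mul (abs_nonneg y),
    mul_div_cancel₀ _ hp0.ne', Real.rpow_two, sq_abs,
    show q * (2 / p) = 2 - 2 * (2 - q) by linear_combination 2 * hqp] at key

theorem abs_mul_abs_le_rpow (hpq : p.HolderConjugate q) (h k : ℝ) :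
    |h| * |k| ≤ |h| ^ p + |k| ^ q := by
  refine (Real.young_inequality_of_nonneg (abs_nonneg h) (abs_nonneg k) hpq).trans ?_
  exact add_le_add (div_le_self (Real.rpow_nonneg (abs_nonneg h) p) hpq.lt.le)
    (div_le_self (Real.rpow_nonneg (abs_nonneg k) q) hpq.symm.lt.le)

theorem two_mul_abs_mul_abs_le {s : ℝ} (hs : 0 < s) (h k : ℝ) :
    2 * (|h| * |k|) ≤ h ^ 2 * s + k ^ 2 * s⁻¹ := by
  rw [← sq_abs h, ← sq_abs k]
  have h1 : s * s⁻¹ = 1 := mul_inv_cancel₀ hs.ne'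
  have h2 : 0 ≤ s * (|h| - s⁻¹ * |k|) ^ 2 := by positivity
  have h3 : s * (|h| - s⁻¹ * |k|) ^ 2 =
      |h| ^ 2 * s - 2 * (|h| * |k|) * (s * s⁻¹) + |k| ^ 2 * s⁻¹ * (s * s⁻¹) := by ring
  rw [h3, h1] at h2
  linarith

theorem isBellman_of_two_le (hpq : p.HolderConjugate q) (hp : 2 ≤ p) :
    IsBellman p q ((q - 1) ^ 2 / 64) fun x y => |x| ^ p + |y| ^ q +
      (q - 1) ^ 2 / 64 * max 0 (|y| ^ q - 3 * |x| ^ p + x ^ 2 * |y| ^ (2 - q)) := by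
  have hq : 1 < q := hpq.symm.lt
  have hq2 : q ≤ 2 := by
    have := hpq.mul_eq_add
    nlinarith
  have ha : 0 < (q - 1) ^ 2 := by
    have : 0 < q - 1 := by linarith
    positivity
  have ha1 : (q - 1) ^ 2 ≤ 1 := by nlinarith
  have hX (x : ℝ) : 0 ≤ |x| ^ p := Real.rpow_nonneg (abs_nonneg x) p
  have hY (y : ℝ) : 0 ≤ |y| ^ q := Real.rpow_nonneg (abs_nonneg y) q
  have hS (x y : ℝ) : max 0 (|y| ^ q - 3 * |x| ^ p + x ^ 2 * |y| ^ (2 - q)) ≤ 2 * |y| ^ q :=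
    max_le (by linarith [hY y]) (by linarith [sq_mul_abs_rpow_le hpq hp x y, hX x])
  refine ⟨by positivity, ?_, ?_, ?_, ?_⟩
  · have c1 : Continuous fun z : ℝ × ℝ => |z.1| ^ p :=
      continuous_fst.abs.rpow_const fun _ => Or.inr (by linarith)
    have c2 : Continuous fun z : ℝ × ℝ => |z.2| ^ q :=
      continuous_snd.abs.rpow_const fun _ => Or.inr (by linarith)
    have c3 : Continuous fun z : ℝ × ℝ => |z.2| ^ (2 - q) :=
      continuous_snd.abs.rpow_const fun _ => Or.inr (by linarith)
    fun_prop
  · intro x y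
    have := hX x
    have := hY y
    positivity
  · intro x y
    have h0 : 0 ≤ max 0 (|y| ^ q - 3 * |x| ^ p + x ^ 2 * |y| ^ (2 - q)) := le_max_left _ _
    nlinarith [hX x, hY y, hS x y]
  intro x y h k
  have X2 := two_mul_abs_rpow_le_second_diff hp x h
  have pos1 := le_max_left 0 (|y + k| ^ q - 3 * |x + h| ^ p + (x + h) ^ 2 * |y + k| ^ (2 - q))
  have pos2 := le_max_left 0 (|y - k| ^ q - 3 * |x - h| ^ p + (x - h) ^ 2 * |y - k| ^ (2 - q))
  have big1 := le_max_right 0 (|y + k| ^ q - 3 * |x + h| ^ p + (x + h) ^ 2 * |y + k| ^ (2 - q))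
  have big2 := le_max_right 0 (|y - k| ^ q - 3 * |x - h| ^ p + (x - h) ^ 2 * |y - k| ^ (2 - q))
  have hSm := hS x y
  set S₁ := max 0 (|y + k| ^ q - 3 * |x + h| ^ p + (x + h) ^ 2 * |y + k| ^ (2 - q))
  set S₂ := max 0 (|y - k| ^ q - 3 * |x - h| ^ p + (x - h) ^ 2 * |y - k| ^ (2 - q))
  have young := abs_mul_abs_le_rpow hpq h k
  have hhk : 0 ≤ |h| * |k| := by positivity
  set a := (q - 1) ^ 2
  rcases le_total |y| (2 * |k|) with hk | hk
  · have Y2 := abs_rpow_le_second_diff_of_abs_le_two_mul hq hq2 hk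
    have hyk : |y| ^ q ≤ 4 * |k| ^ q := by
      calc |y| ^ q ≤ (2 * |k|) ^ q := Real.rpow_le_rpow (abs_nonneg y) hk (by linarith)
        _ = 2 ^ q * |k| ^ q := Real.mul_rpow (by norm_num) (abs_nonneg k)
        _ ≤ 4 * |k| ^ q := by
          refine mul_le_mul_of_nonneg_right ?_ (hY k)
          calc (2 : ℝ) ^ q ≤ 2 ^ (2 : ℝ) :=
                Real.rpow_le_rpow_of_exponent_le (by norm_num) hq2
            _ = 4 := by norm_num
    linarith [hX h, hY k, mul_nonneg ha.le (hY k), mul_nonneg ha.le pos1, mul_nonneg ha.le pos2,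
      mul_le_mul_of_nonneg_left hSm ha.le, mul_le_mul_of_nonneg_left hyk ha.le,
      mul_le_mul_of_nonneg_left young ha.le, mul_le_mul_of_nonneg_right ha1 (hX h)]
  have hkle : |k| ≤ |y| := by linarith [abs_nonneg k]
  rcases eq_or_ne y 0 with rfl | hy
  · have hk0 : k = 0 := by
      rw [abs_zero] at hkle
      exact abs_nonpos_iff.1 hkle
    subst hk0
    have hmid := hSm
    simp only [abs_zero, Real.zero_rpow (by linarith : q ≠ 0), mul_zero, add_zero, sub_zero,
      zero_sub] at X2 hmid pos1 pos2 ⊢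
    linarith [hX h, mul_nonneg ha.le pos1, mul_nonneg ha.le pos2,
      mul_le_mul_of_nonneg_left hmid ha.le]
  have hyp : 0 < |y| := abs_pos.2 hy
  have Y2 := second_diff_rpow_ge_of_abs_le hq hq2 hy hkle
  have hyinv : |y| ^ (q - 2) = (|y| ^ (2 - q))⁻¹ := by
    rw [← Real.rpow_neg hyp.le]
    ring_nf
  have hs : 0 < |y| ^ (2 - q) := Real.rpow_pos_of_pos hyp _
  have amgm := two_mul_abs_mul_abs_le hs h k
  rw [hyinv] at Y2
  change a * _ ≤ _ at Y2
  have hY2 : 0 ≤ k ^ 2 * (|y| ^ (2 - q))⁻¹ := by positivity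
  rcases le_total (|y| ^ q) (|h| ^ p) with hh | hh
  · have hkq : |k| ^ q ≤ |y| ^ q := Real.rpow_le_rpow (abs_nonneg k) hkle (by linarith)
    linarith [hX h, mul_nonneg ha.le pos1, mul_nonneg ha.le pos2, mul_nonneg ha.le hY2,
      mul_le_mul_of_nonneg_left hSm ha.le, mul_le_mul_of_nonneg_left hh ha.le,
      mul_le_mul_of_nonneg_left young ha.le, mul_le_mul_of_nonneg_right ha1 (hX h),
      mul_le_mul_of_nonneg_left hkq ha.le]
  rcases le_total (|y| ^ q - 3 * |x| ^ p + x ^ 2 * |y| ^ (2 - q)) 0 with hneg | hpos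
  · rw [max_eq_left hneg]
    have hxy : |y| ^ (2 - q) ≤ 3 * |x| ^ (p - 2) := by
      refine abs_rpow_two_sub_le hpq hp ?_
      have : 0 ≤ x ^ 2 * |y| ^ (2 - q) := by positivity
      linarith
    have X2' := two_mul_sq_mul_abs_rpow_le_second_diff hp x h
    have hx0 : 0 ≤ h ^ 2 * |x| ^ (p - 2) := by positivity
    linarith [mul_nonneg ha.le pos1, mul_nonneg ha.le pos2, mul_le_mul_of_nonneg_left amgm ha.le,
      mul_le_mul_of_nonneg_left hxy (mul_nonneg ha.le (sq_nonneg h)),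
      mul_le_mul_of_nonneg_right ha1 hx0, mul_nonneg ha.le hY2]
  rw [max_eq_right hpos]
  have hxy : |x| ^ p ≤ |y| ^ q := by linarith [sq_mul_abs_rpow_le hpq hp x y, hX x]
  have T2 := second_diff_sq_mul_abs_rpow_ge (h := h) (by linarith : 0 ≤ 2 - q)
    (by linarith : 2 - q ≤ 1) hy (by linarith : |k| ≤ |y| / 2) (sq_le_abs_rpow hpq hp hxy)
  rw [Real.rpow_neg hyp.le] at T2
  have X0 : 0 ≤ |x + h| ^ p + |x - h| ^ p - 2 * |x| ^ p := by linarith [hX h]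
  have hh0 : 0 ≤ h ^ 2 * |y| ^ (2 - q) := by positivity
  linarith [mul_le_mul_of_nonneg_left big1 ha.le, mul_le_mul_of_nonneg_left big2 ha.le,
    mul_le_mul_of_nonneg_left T2 ha.le, mul_le_mul_of_nonneg_left Y2 ha.le,
    mul_le_mul_of_nonneg_left amgm ha.le, mul_le_mul_of_nonneg_right ha1 X0,
    mul_nonneg ha.le hY2, mul_nonneg ha.le (mul_nonneg ha.le hY2)]

theorem exists_isBellman (hpq : p.HolderConjugate q) : ∃ c B, IsBellman p q c B := by
  rcases le_total 2 p with hp | hp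
  · exact ⟨_, _, isBellman_of_two_le hpq hp⟩
  · have hq : 2 ≤ q := by
      have := hpq.mul_eq_add
      have := hpq.lt
      nlinarith
    exact ⟨_, _, (isBellman_of_two_le hpq.symm hq).swap⟩

theorem abs_mul_abs_le_of_parallel (a b c d : ℝ) :
    |a| * |d| ≤ 2 * (|a| * |c| + |b| * |d| + |a - b| * |c - d|) := by
  simp only [← abs_mul]
  set S := |a * c| + |b * d| + |(a - b) * (c - d)| with hS
  have hS0 : 0 ≤ S := by positivity
  by_contra! hlt
  have hsum : |a * d| - |b * c| ≤ S := by
    calc |a * d| - |b * c| ≤ |a * d + b * c| := by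
          have := abs_sub_abs_le_abs_sub (a * d) (-(b * c))
          rwa [abs_neg, sub_neg_eq_add] at this
      _ = |a * c + b * d - (a - b) * (c - d)| := by ring_nf
      _ ≤ |a * c + b * d| + |(a - b) * (c - d)| := abs_sub _ _
      _ ≤ S := by linarith [abs_add_le (a * c) (b * d)]
  have hprod : |a * d| * |b * c| = |a * c| * |b * d| := by
    simp only [← abs_mul]
    ring_nf
  have h1 : 2 * S * S < |a * d| * |b * c| :=
    mul_lt_mul'' hlt (by linarith) (by linarith) hS0
  have h2 := abs_nonneg (a * c)
  have h3 := abs_nonneg (b * d)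
  have h4 : |a * c| * |b * d| ≤ S * S :=
    mul_le_mul (by linarith [abs_nonneg ((a - b) * (c - d))])
      (by linarith [abs_nonneg ((a - b) * (c - d))]) h3 hS0
  nlinarith

variable {c : ℝ} {B : ℝ → ℝ → ℝ}

theorem IsBellman.two_point (hB : IsBellman p q c B) (x₀ y₀ x₁ y₁ : ℝ) :
    c * (|x₁ - x₀| * |y₁ - y₀|) ≤
      4 * (B x₀ y₀ + B x₁ y₁ - 2 * B ((x₀ + x₁) / 2) ((y₀ + y₁) / 2)) := by
  have h := hB.second_diff ((x₀ + x₁) / 2) ((y₀ + y₁) / 2) ((x₁ - x₀) / 2) ((y₁ - y₀) / 2)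
  rw [abs_div, abs_div, abs_two, show (x₀ + x₁) / 2 + (x₁ - x₀) / 2 = x₁ by ring,
    show (y₀ + y₁) / 2 + (y₁ - y₀) / 2 = y₁ by ring,
    show (x₀ + x₁) / 2 - (x₁ - x₀) / 2 = x₀ by ring,
    show (y₀ + y₁) / 2 - (y₁ - y₀) / 2 = y₀ by ring] at h
  linarith

theorem IsBellman.four_point_pair (hB : IsBellman p q c B) (x₀ y₀ x₁ y₁ x₂ y₂ x₃ y₃ : ℝ) :
    c * (|x₁ - x₀| * |y₁ - y₀|) ≤ 4 * (B x₀ y₀ + B x₁ y₁ + B x₂ y₂ + B x₃ y₃ -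
      4 * B ((x₀ + x₁ + x₂ + x₃) / 4) ((y₀ + y₁ + y₂ + y₃) / 4)) := by
  have h1 := hB.two_point x₀ y₀ x₁ y₁
  have h2 := hB.two_point x₂ y₂ x₃ y₃
  have h3 := hB.two_point ((x₀ + x₁) / 2) ((y₀ + y₁) / 2) ((x₂ + x₃) / 2) ((y₂ + y₃) / 2)
  rw [show ((x₀ + x₁) / 2 + (x₂ + x₃) / 2) / 2 = (x₀ + x₁ + x₂ + x₃) / 4 by ring,
    show ((y₀ + y₁) / 2 + (y₂ + y₃) / 2) / 2 = (y₀ + y₁ + y₂ + y₃) / 4 by ring] at h3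
  have p2 : 0 ≤ c * (|x₃ - x₂| * |y₃ - y₂|) := by
    have := hB.pos
    positivity
  have p3 : 0 ≤ c * (|(x₂ + x₃) / 2 - (x₀ + x₁) / 2| * |(y₂ + y₃) / 2 - (y₀ + y₁) / 2|) := by
    have := hB.pos
    positivity
  linarith

theorem IsBellman.four_point (hB : IsBellman p q c B) (x₀ y₀ : ℝ) (x y : Fin 3 → ℝ)
    (j k : Fin 3) :
    c * (|x j - x₀| * |y k - y₀|) ≤ 24 * (B x₀ y₀ + ∑ i, B (x i) (y i) -
      4 * B ((x₀ + ∑ i, x i) / 4) ((y₀ + ∑ i, y i) / 4)) := by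
  simp only [Fin.sum_univ_three, ← add_assoc]
  set G := B x₀ y₀ + B (x 0) (y 0) + B (x 1) (y 1) + B (x 2) (y 2) -
      4 * B ((x₀ + x 0 + x 1 + x 2) / 4) ((y₀ + y 0 + y 1 + y 2) / 4) with hG
  have h0 : c * (|x 0 - x₀| * |y 0 - y₀|) ≤ 4 * G :=
    hB.four_point_pair x₀ y₀ (x 0) (y 0) (x 1) (y 1) (x 2) (y 2)
  have h1 : c * (|x 1 - x₀| * |y 1 - y₀|) ≤ 4 * G := by
    convert hB.four_point_pair x₀ y₀ (x 1) (y 1) (x 0) (y 0) (x 2) (y 2) using 2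
    rw [hG, add_right_comm x₀, add_right_comm y₀]
    ring
  have h2 : c * (|x 2 - x₀| * |y 2 - y₀|) ≤ 4 * G := by
    convert hB.four_point_pair x₀ y₀ (x 2) (y 2) (x 0) (y 0) (x 1) (y 1) using 2
    rw [hG, show x₀ + x 2 + x 0 + x 1 = x₀ + x 0 + x 1 + x 2 by ring,
      show y₀ + y 2 + y 0 + y 1 = y₀ + y 0 + y 1 + y 2 by ring]
    ring
  have h01 : c * (|x 0 - x 1| * |y 0 - y 1|) ≤ 4 * G := by
    convert hB.four_point_pair (x 1) (y 1) (x 0) (y 0) x₀ y₀ (x 2) (y 2) using 2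
    rw [hG, show x 1 + x 0 + x₀ + x 2 = x₀ + x 0 + x 1 + x 2 by ring,
      show y 1 + y 0 + y₀ + y 2 = y₀ + y 0 + y 1 + y 2 by ring]
    ring
  have h02 : c * (|x 0 - x 2| * |y 0 - y 2|) ≤ 4 * G := by
    convert hB.four_point_pair (x 2) (y 2) (x 0) (y 0) x₀ y₀ (x 1) (y 1) using 2
    rw [hG, show x 2 + x 0 + x₀ + x 1 = x₀ + x 0 + x 1 + x 2 by ring,
      show y 2 + y 0 + y₀ + y 1 = y₀ + y 0 + y 1 + y 2 by ring]
    ring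
  have h12 : c * (|x 1 - x 2| * |y 1 - y 2|) ≤ 4 * G := by
    convert hB.four_point_pair (x 2) (y 2) (x 1) (y 1) x₀ y₀ (x 0) (y 0) using 2
    rw [hG, show x 2 + x 1 + x₀ + x 0 = x₀ + x 0 + x 1 + x 2 by ring,
      show y 2 + y 1 + y₀ + y 0 = y₀ + y 0 + y 1 + y 2 by ring]
    ring
  have cross (i l : Fin 3) (hi : c * (|x i - x₀| * |y i - y₀|) ≤ 4 * G)
      (hl : c * (|x l - x₀| * |y l - y₀|) ≤ 4 * G)
      (hil : c * (|x i - x l| * |y i - y l|) ≤ 4 * G) :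
      c * (|x i - x₀| * |y l - y₀|) ≤ 24 * G := by
    have := abs_mul_abs_le_of_parallel (x i - x₀) (x l - x₀) (y i - y₀) (y l - y₀)
    rw [sub_sub_sub_cancel_right, sub_sub_sub_cancel_right] at this
    linarith [mul_le_mul_of_nonneg_left this hB.pos.le]
  have refl (i : Fin 3) : |x i - x i| * |y i - y i| = 0 := by simp
  have hG0 : 0 ≤ 4 * G := by
    refine le_trans ?_ h0
    have := hB.pos
    positivity
  have symm (i l : Fin 3) : |x i - x l| * |y i - y l| = |x l - x i| * |y l - y i| := by
    rw [abs_sub_comm (x i), abs_sub_comm (y i)]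
  have pairs (i l : Fin 3) : c * (|x i - x l| * |y i - y l|) ≤ 4 * G := by
    fin_cases i <;> fin_cases l <;>
      first
        | assumption
        | (simp only [refl, mul_zero]; assumption)
        | (rw [symm]; assumption)
  have base (i : Fin 3) : c * (|x i - x₀| * |y i - y₀|) ≤ 4 * G := by
    fin_cases i <;> assumption
  exact cross j k (base j) (base k) (pairs j k)

end Bellman

section DifferenceOperators

variable {E : Type*} [AddCommGroup E]

/-- Translation by `a`, as a linear operator on real-valued functions. -/
def translation (a : E) : (E → ℝ) →ₗ[ℝ] (E → ℝ) := LinearMap.funLeft ℝ ℝ (· + a)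

/-- The forward difference operator with step `a`. -/
def forwardDiff (a : E) : (E → ℝ) →ₗ[ℝ] (E → ℝ) := translation a - 1

/-- The mean of a function over the four points `x`, `x + a 0`, `x + a 1`, `x + a 2`. -/
noncomputable def stencilMean (a : Fin 3 → E) : (E → ℝ) →ₗ[ℝ] (E → ℝ) :=
  (1 / 4 : ℝ) • (1 + ∑ i, translation (a i))

@[simp]
theorem translation_apply (a : E) (f : E → ℝ) (x : E) : translation a f x = f (x + a) := rfl

@[simp]
theorem forwardDiff_apply (a : E) (f : E → ℝ) (x : E) :
    forwardDiff a f x = f (x + a) - f x := rfl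

theorem stencilMean_apply (a : Fin 3 → E) (f : E → ℝ) (x : E) :
    stencilMean a f x = (f x + ∑ i, f (x + a i)) / 4 := by
  simp [stencilMean, Module.End.one_apply]
  ring

theorem commute_translation (a b : E) : Commute (translation a) (translation b) := by
  refine LinearMap.ext fun f => funext fun x => ?_
  simp [Module.End.mul_apply, add_right_comm]

theorem commute_forwardDiff (a b : E) : Commute (forwardDiff a) (forwardDiff b) :=
  ((commute_translation a b).sub_right (Commute.one_right _)).sub_left (Commute.one_left _)

theorem commute_forwardDiff_stencilMean (a : E) (b : Fin 3 → E) :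
    Commute (forwardDiff a) (stencilMean b) := by
  refine Commute.smul_right (Commute.add_right (Commute.one_right _) ?_) _
  exact Commute.sum_right _ _ _ fun i _ =>
    (commute_translation a (b i)).sub_left (Commute.one_left _)

theorem forwardDiff_stencilMean_pow (a : E) (b : Fin 3 → E) (n : ℕ) (f : E → ℝ) :
    forwardDiff a ((stencilMean b ^ n) f) = (stencilMean b ^ n) (forwardDiff a f) :=
  LinearMap.congr_fun ((commute_forwardDiff_stencilMean a b).pow_right n).eq f

/-- The symmetrised difference `δ_j v_i + δ_i v_j`. -/
def symDiffQuot (a : Fin 3 → E) (v : Fin 3 → E → ℝ) (i j : Fin 3) : E → ℝ :=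
  forwardDiff (a j) (v i) + forwardDiff (a i) (v j)

theorem two_smul_forwardDiff_forwardDiff (a : Fin 3 → E) (v : Fin 3 → E → ℝ) (i j k : Fin 3) :
    (2 : ℝ) • forwardDiff (a j) (forwardDiff (a k) (v i)) =
      forwardDiff (a k) (symDiffQuot a v i j) + forwardDiff (a j) (symDiffQuot a v i k) -
        forwardDiff (a i) (symDiffQuot a v j k) := by
  have comm (l m : Fin 3) (f : E → ℝ) :
      forwardDiff (a l) (forwardDiff (a m) f) = forwardDiff (a m) (forwardDiff (a l) f) :=
    LinearMap.congr_fun (commute_forwardDiff (a l) (a m)).eq f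
  simp only [symDiffQuot, map_add, comm j k, comm k i, comm j i]
  rw [two_smul]
  abel

theorem abs_forwardDiff_stencilMean_pow_le (a : Fin 3 → E) (v : Fin 3 → E → ℝ) (i j k : Fin 3)
    (n : ℕ) (x : E) :
    |forwardDiff (a j) ((stencilMean a ^ n) (forwardDiff (a k) (v i))) x| ≤
      2 * ∑ t : (Fin 3 × Fin 3) × Fin 3,
        |forwardDiff (a t.2) ((stencilMean a ^ n) (symDiffQuot a v t.1.1 t.1.2)) x| := by
  have key := congrFun
    (congrArg (stencilMean a ^ n) (two_smul_forwardDiff_forwardDiff a v i j k)) x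
  simp only [map_add, map_sub, map_smul, ← forwardDiff_stencilMean_pow (_ : E) a n,
    Pi.add_apply, Pi.sub_apply, Pi.smul_apply, smul_eq_mul] at key
  have le_sum (α β l : Fin 3) := Finset.single_le_sum (f := fun t : (Fin 3 × Fin 3) × Fin 3 =>
    |forwardDiff (a t.2) ((stencilMean a ^ n) (symDiffQuot a v t.1.1 t.1.2)) x|)
    (fun _ _ => abs_nonneg _) (Finset.mem_univ ((α, β), l))
  have h1 := abs_le.1 (le_sum i j k)
  have h2 := abs_le.1 (le_sum i k j)
  have h3 := abs_le.1 (le_sum j k i)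
  rw [← forwardDiff_stencilMean_pow, abs_le]
  constructor <;> linarith

end DifferenceOperators

section TestFunctions

variable {E : Type*} [NormedAddCommGroup E]

/-- Continuous real-valued functions with compact support. -/
structure IsTestFunction (f : E → ℝ) : Prop where
  continuous : Continuous f
  hasCompactSupport : HasCompactSupport f

namespace IsTestFunction

variable {f g : E → ℝ}

theorem comp₂ (hf : IsTestFunction f) (hg : IsTestFunction g) {m : ℝ → ℝ → ℝ}
    (hm : Continuous fun z : ℝ × ℝ => m z.1 z.2) (hm0 : m 0 0 = 0) :
    IsTestFunction fun x => m (f x) (g x) where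
  continuous := hm.comp (hf.continuous.prodMk hg.continuous)
  hasCompactSupport := hf.hasCompactSupport.comp₂_left hg.hasCompactSupport hm0

theorem comp_left (hf : IsTestFunction f) {φ : ℝ → ℝ} (hφ : Continuous φ) (hφ0 : φ 0 = 0) :
    IsTestFunction fun x => φ (f x) :=
  hf.comp₂ hf (m := fun x _ => φ x) (hφ.comp continuous_fst) hφ0

theorem add (hf : IsTestFunction f) (hg : IsTestFunction g) : IsTestFunction (f + g) :=
  hf.comp₂ hg continuous_add (add_zero 0)

theorem mul (hf : IsTestFunction f) (hg : IsTestFunction g) :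
    IsTestFunction fun x => f x * g x :=
  hf.comp₂ hg continuous_mul (mul_zero 0)

theorem abs (hf : IsTestFunction f) : IsTestFunction fun x => |f x| :=
  hf.comp_left continuous_abs abs_zero

theorem sq (hf : IsTestFunction f) : IsTestFunction fun x => f x ^ 2 :=
  hf.comp_left (continuous_pow 2) (zero_pow two_ne_zero)

theorem abs_rpow (hf : IsTestFunction f) {p : ℝ} (hp : 0 < p) :
    IsTestFunction fun x => |f x| ^ p :=
  hf.abs.comp_left (Real.continuous_rpow_const hp.le) (Real.zero_rpow hp.ne')

theorem translation (hf : IsTestFunction f) (a : E) : IsTestFunction fun x => f (x + a) where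
  continuous := hf.continuous.comp (continuous_add_const a)
  hasCompactSupport := hf.hasCompactSupport.comp_homeomorph (Homeomorph.addRight a)

theorem forwardDiff (hf : IsTestFunction f) (a : E) : IsTestFunction (forwardDiff a f) :=
  (hf.translation a).comp₂ hf continuous_sub (sub_zero 0)

theorem stencilMean (hf : IsTestFunction f) (a : Fin 3 → E) :
    IsTestFunction (stencilMean a f) := by
  have h := (((hf.add (hf.translation (a 0))).add (hf.translation (a 1))).add
    (hf.translation (a 2))).comp_left (continuous_id.div_const 4) (zero_div 4)
  convert h using 1
  funext x
  simp [stencilMean_apply, Fin.sum_univ_three, add_assoc]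

theorem stencilMean_pow (hf : IsTestFunction f) (a : Fin 3 → E) (n : ℕ) :
    IsTestFunction ((_root_.stencilMean a ^ n) f) := by
  induction n with
  | zero => exact hf
  | succ n ih =>
    rw [pow_succ', Module.End.mul_apply]
    exact ih.stencilMean a

theorem symDiffQuot {v : Fin 3 → E → ℝ} (hv : ∀ i, IsTestFunction (v i)) (a : Fin 3 → E)
    (i j : Fin 3) : IsTestFunction (symDiffQuot a v i j) :=
  ((hv i).forwardDiff (a j)).add ((hv j).forwardDiff (a i))

variable [MeasurableSpace E] [BorelSpace E] {μ : Measure E} [IsFiniteMeasureOnCompacts μ]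

theorem integrable (hf : IsTestFunction f) : Integrable f μ :=
  hf.continuous.integrable_of_hasCompactSupport hf.hasCompactSupport

variable [μ.IsAddRightInvariant]

theorem integral_stencil_sub (hf : IsTestFunction f) (hg : IsTestFunction g) (a : Fin 3 → E)
    {m : ℝ → ℝ → ℝ} (hm : Continuous fun z : ℝ × ℝ => m z.1 z.2) (hm0 : m 0 0 = 0) :
    Integrable (fun x => m (f x) (g x) + ∑ i, m (f (x + a i)) (g (x + a i)) -
        4 * m (_root_.stencilMean a f x) (_root_.stencilMean a g x)) μ ∧
      ∫ x, (m (f x) (g x) + ∑ i, m (f (x + a i)) (g (x + a i)) -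
        4 * m (_root_.stencilMean a f x) (_root_.stencilMean a g x)) ∂μ =
      4 * (∫ x, m (f x) (g x) ∂μ -
        ∫ x, m (_root_.stencilMean a f x) (_root_.stencilMean a g x) ∂μ) := by
  have h := hf.comp₂ hg hm hm0
  have hi : Integrable (fun x => m (f x) (g x)) μ := h.integrable
  have hs (i : Fin 3) : Integrable (fun x => m (f (x + a i)) (g (x + a i))) μ :=
    (h.translation (a i)).integrable
  have hP : Integrable
      (fun x => m (_root_.stencilMean a f x) (_root_.stencilMean a g x)) μ :=
    ((hf.stencilMean a).comp₂ (hg.stencilMean a) hm hm0).integrable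
  have hsum := integrable_finsetSum Finset.univ fun i _ => hs i
  have hadd : Integrable (fun x => m (f x) (g x) + ∑ i, m (f (x + a i)) (g (x + a i))) μ :=
    hi.add hsum
  refine ⟨hadd.sub (hP.const_mul 4), ?_⟩
  rw [integral_sub hadd (hP.const_mul 4), integral_const_mul, integral_add hi hsum,
    integral_finsetSum _ fun i _ => hs i]
  simp only [fun i => integral_add_right_eq_self (μ := μ) (fun x => m (f x) (g x)) (a i)]
  simp
  ring

end IsTestFunction

theorem sum_range_le_of_le_sub {u w : ℕ → ℝ} (h : ∀ n, u n ≤ w n - w (n + 1))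
    (hw : ∀ n, 0 ≤ w n) (N : ℕ) : ∑ n ∈ Finset.range N, u n ≤ w 0 :=
  calc ∑ n ∈ Finset.range N, u n ≤ ∑ n ∈ Finset.range N, (w n - w (n + 1)) :=
        Finset.sum_le_sum fun n _ => h n
    _ = w 0 - w N := Finset.sum_range_sub' w N
    _ ≤ w 0 := sub_le_self _ (hw N)

variable [MeasurableSpace E] [BorelSpace E] {μ : Measure E} [IsFiniteMeasureOnCompacts μ]
  [μ.IsAddRightInvariant] {f g : E → ℝ}

namespace IsBellman

variable {p q c : ℝ} {B : ℝ → ℝ → ℝ}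

theorem apply_zero_zero (hB : IsBellman p q c B) (hpq : p.HolderConjugate q) : B 0 0 = 0 := by
  refine le_antisymm ?_ (hB.nonneg 0 0)
  simpa [Real.zero_rpow hpq.ne_zero, Real.zero_rpow hpq.symm.ne_zero] using hB.le 0 0

theorem integral_forwardDiff_le (hB : IsBellman p q c B) (hpq : p.HolderConjugate q)
    (hf : IsTestFunction f) (hg : IsTestFunction g) (a : Fin 3 → E) (j k : Fin 3) :
    c * ∫ x, |forwardDiff (a j) f x| * |forwardDiff (a k) g x| ∂μ ≤
      96 * (∫ x, B (f x) (g x) ∂μ - ∫ x, B (stencilMean a f x) (stencilMean a g x) ∂μ) := by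
  obtain ⟨hint, heq⟩ :=
    hf.integral_stencil_sub (μ := μ) hg a hB.continuous (hB.apply_zero_zero hpq)
  rw [show (96 : ℝ) = 24 * 4 by norm_num, mul_assoc, ← heq, ← integral_const_mul,
    ← integral_const_mul]
  refine integral_mono
    (((hf.forwardDiff (a j)).abs.mul (hg.forwardDiff (a k)).abs).integrable.const_mul c)
    (hint.const_mul 24) fun x => ?_
  simpa only [stencilMean_apply, forwardDiff_apply] using
    hB.four_point (f x) (g x) (fun i => f (x + a i)) (fun i => g (x + a i)) j k

/-- The bilinear embedding along the iterates of `stencilMean`. -/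
theorem sum_integral_forwardDiff_le (hB : IsBellman p q c B) (hpq : p.HolderConjugate q)
    (hf : IsTestFunction f) (hg : IsTestFunction g) (a : Fin 3 → E) (j k : Fin 3) (N : ℕ) :
    ∑ n ∈ Finset.range N, ∫ x, |forwardDiff (a j) ((stencilMean a ^ n) f) x| *
        |forwardDiff (a k) ((stencilMean a ^ n) g) x| ∂μ ≤
      192 / c * (∫ x, |f x| ^ p ∂μ + ∫ x, |g x| ^ q ∂μ) := by
  have h := sum_range_le_of_le_sub
    (u := fun n => c * ∫ x, |forwardDiff (a j) ((stencilMean a ^ n) f) x| *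
        |forwardDiff (a k) ((stencilMean a ^ n) g) x| ∂μ)
    (w := fun n => 96 * ∫ x, B ((stencilMean a ^ n) f x) ((stencilMean a ^ n) g x) ∂μ)
    (fun n => by
      rw [← mul_sub, pow_succ']
      exact hB.integral_forwardDiff_le hpq (hf.stencilMean_pow a n) (hg.stencilMean_pow a n) a j k)
    (fun n => mul_nonneg (by norm_num) (integral_nonneg fun x => hB.nonneg _ _)) N
  have hfp : Integrable (fun x => |f x| ^ p) μ := (hf.abs_rpow hpq.pos).integrable
  have hgq : Integrable (fun x => |g x| ^ q) μ := (hg.abs_rpow hpq.symm.pos).integrable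
  have hle : ∫ x, B (f x) (g x) ∂μ ≤ 2 * (∫ x, |f x| ^ p ∂μ + ∫ x, |g x| ^ q ∂μ) := by
    rw [← integral_add hfp hgq, ← integral_const_mul]
    exact integral_mono (hf.comp₂ hg hB.continuous (hB.apply_zero_zero hpq)).integrable
      ((hfp.add hgq).const_mul 2) fun x => hB.le _ _
  rw [← Finset.mul_sum] at h
  rw [div_mul_eq_mul_div, le_div_iff₀' hB.pos]
  simp only [pow_zero, Module.End.one_apply] at h
  linarith

end IsBellman

theorem abs_mean_mul_sub_mul_mean_le (x₀ y₀ : ℝ) (x y : Fin 3 → ℝ) :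
    |x₀ * y₀ + ∑ i, x i * y i - 4 * ((x₀ + ∑ i, x i) / 4 * ((y₀ + ∑ i, y i) / 4))| ≤
      4 * ∑ s : Fin 3 × Fin 3, |x s.1 - x₀| * |y s.2 - y₀| := by
  have key : x₀ * y₀ + ∑ i, x i * y i - 4 * ((x₀ + ∑ i, x i) / 4 * ((y₀ + ∑ i, y i) / 4)) =
      ∑ i, (x i - x₀) * (y i - y₀) -
        (1 / 4) * ∑ s : Fin 3 × Fin 3, (x s.1 - x₀) * (y s.2 - y₀) := by
    simp only [Fintype.sum_prod_type, Fin.sum_univ_three]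
    ring
  have hdiag : |∑ i, (x i - x₀) * (y i - y₀)| ≤
      ∑ s : Fin 3 × Fin 3, |x s.1 - x₀| * |y s.2 - y₀| := by
    refine (Finset.abs_sum_le_sum_abs _ _).trans ?_
    rw [Fintype.sum_prod_type]
    refine Finset.sum_le_sum fun i _ => ?_
    rw [abs_mul]
    exact Finset.single_le_sum (f := fun j => |x i - x₀| * |y j - y₀|)
      (fun _ _ => by positivity) (Finset.mem_univ i)
  have hall : |∑ s : Fin 3 × Fin 3, (x s.1 - x₀) * (y s.2 - y₀)| ≤
      ∑ s : Fin 3 × Fin 3, |x s.1 - x₀| * |y s.2 - y₀| := by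
    refine (Finset.abs_sum_le_sum_abs _ _).trans_eq ?_
    simp only [abs_mul]
  rw [abs_le] at hdiag hall
  rw [key, abs_le]
  constructor <;> linarith

theorem integral_mul_sub_integral_stencilMean_le (hf : IsTestFunction f) (hg : IsTestFunction g)
    (a : Fin 3 → E) :
    ∫ x, f x * g x ∂μ - ∫ x, stencilMean a f x * stencilMean a g x ∂μ ≤
      ∑ s : Fin 3 × Fin 3, ∫ x, |forwardDiff (a s.1) f x| * |forwardDiff (a s.2) g x| ∂μ := by
  obtain ⟨hint, heq⟩ :=
    hf.integral_stencil_sub (μ := μ) hg a continuous_mul (mul_zero 0)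
  have hs (s : Fin 3 × Fin 3) :
      Integrable (fun x => |forwardDiff (a s.1) f x| * |forwardDiff (a s.2) g x|) μ :=
    ((hf.forwardDiff (a s.1)).abs.mul (hg.forwardDiff (a s.2)).abs).integrable
  have hsum := integrable_finsetSum Finset.univ fun s _ => hs s
  rw [← mul_le_mul_iff_right₀ (by norm_num : (0 : ℝ) < 4), ← heq,
    ← integral_finsetSum _ fun s _ => hs s, ← integral_const_mul]
  refine integral_mono hint (hsum.const_mul 4) fun x => ?_
  simpa only [stencilMean_apply, forwardDiff_apply] using (le_abs_self _).trans
    (abs_mean_mul_sub_mul_mean_le (f x) (g x) (fun i => f (x + a i)) (fun i => g (x + a i)))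

theorem integral_mul_le_sum_add (hf : IsTestFunction f) (hg : IsTestFunction g)
    (a : Fin 3 → E) (N : ℕ) :
    ∫ x, f x * g x ∂μ ≤
      ∑ n ∈ Finset.range N, ∑ s : Fin 3 × Fin 3,
        ∫ x, |forwardDiff (a s.1) ((stencilMean a ^ n) f) x| *
          |forwardDiff (a s.2) ((stencilMean a ^ n) g) x| ∂μ +
      ∫ x, (stencilMean a ^ N) f x * (stencilMean a ^ N) g x ∂μ := by
  rw [← sub_le_iff_le_add]
  have h := Finset.sum_range_sub'
    (fun n => ∫ x, (stencilMean a ^ n) f x * (stencilMean a ^ n) g x ∂μ) N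
  simp only [pow_zero, Module.End.one_apply] at h
  rw [← h]
  refine Finset.sum_le_sum fun n _ => ?_
  rw [pow_succ']
  exact integral_mul_sub_integral_stencilMean_le (hf.stencilMean_pow a n) (hg.stencilMean_pow a n) a

theorem integral_forwardDiff_sq_le (hf : IsTestFunction f) (a : Fin 3 → E) (k : Fin 3) :
    ∫ x, forwardDiff (a k) f x ^ 2 ∂μ ≤
      16 * ∫ x, f x ^ 2 ∂μ - 16 * ∫ x, stencilMean a f x ^ 2 ∂μ := by
  obtain ⟨hint, heq⟩ := hf.integral_stencil_sub (μ := μ) hf a (m := fun x _ => x ^ 2)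
    (continuous_fst.pow 2) (zero_pow two_ne_zero)
  rw [← mul_sub, show (16 : ℝ) = 4 * 4 by norm_num, mul_assoc, ← heq, ← integral_const_mul]
  refine integral_mono (hf.forwardDiff (a k)).sq.integrable (hint.const_mul 4) fun x => ?_
  simp only [stencilMean_apply, forwardDiff_apply, Fin.sum_univ_three]
  have h01 := sq_nonneg (f (x + a 0) - f (x + a 1))
  have h02 := sq_nonneg (f (x + a 0) - f (x + a 2))
  have h12 := sq_nonneg (f (x + a 1) - f (x + a 2))
  have h0 := sq_nonneg (f (x + a 0) - f x)
  have h1 := sq_nonneg (f (x + a 1) - f x)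
  have h2 := sq_nonneg (f (x + a 2) - f x)
  fin_cases k <;> simp only [Fin.zero_eta, Fin.mk_one, Fin.reduceFinMk] <;> nlinarith

theorem integral_stencilMean_pow_sq_le (hf : IsTestFunction f) (a : Fin 3 → E) (n : ℕ) :
    ∫ x, (stencilMean a ^ n) f x ^ 2 ∂μ ≤ ∫ x, f x ^ 2 ∂μ := by
  induction n with
  | zero => rfl
  | succ n ih =>
    have h := integral_forwardDiff_sq_le (μ := μ) (hf.stencilMean_pow a n) a 0
    have h0 : 0 ≤ ∫ x, forwardDiff (a 0) ((stencilMean a ^ n) f) x ^ 2 ∂μ :=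
      integral_nonneg fun x => sq_nonneg _
    rw [pow_succ', Module.End.mul_apply]
    linarith

theorem tendsto_integral_stencilMean_pow_forwardDiff_sq (hf : IsTestFunction f) (a : Fin 3 → E)
    (k : Fin 3) :
    Filter.Tendsto (fun n => ∫ x, (stencilMean a ^ n) (forwardDiff (a k) f) x ^ 2 ∂μ)
      Filter.atTop (nhds 0) := by
  refine (summable_of_sum_range_le (fun n => integral_nonneg fun x => sq_nonneg _)
    (sum_range_le_of_le_sub (w := fun n => 16 * ∫ x, (stencilMean a ^ n) f x ^ 2 ∂μ)
      (fun n => ?_) fun n => ?_)).tendsto_atTop_zero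
  · rw [← forwardDiff_stencilMean_pow, pow_succ']
    exact integral_forwardDiff_sq_le (hf.stencilMean_pow a n) a k
  · exact mul_nonneg (by norm_num) (integral_nonneg fun x => sq_nonneg _)

theorem exists_integral_stencilMean_pow_mul_le (hf : IsTestFunction f) (hg : IsTestFunction g)
    (a : Fin 3 → E) (k : Fin 3) {δ : ℝ} (hδ : 0 < δ) :
    ∃ N, ∫ x, (stencilMean a ^ N) (forwardDiff (a k) f) x * (stencilMean a ^ N) g x ∂μ ≤ δ := by
  set G := ∫ x, g x ^ 2 ∂μ
  have hG : 0 ≤ G := integral_nonneg fun x => sq_nonneg _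
  set η := δ / (G + 1)
  have hη : 0 < η := by positivity
  obtain ⟨N, hN⟩ := ((tendsto_integral_stencilMean_pow_forwardDiff_sq (μ := μ) hf a k).eventually
    (gt_mem_nhds (mul_pos hη hδ))).exists
  refine ⟨N, ?_⟩
  have hF := (hf.forwardDiff (a k)).stencilMean_pow a N
  have hGN := hg.stencilMean_pow a N
  have hFi : Integrable (fun x => (stencilMean a ^ N) (forwardDiff (a k) f) x ^ 2) μ :=
    hF.sq.integrable
  have hGi : Integrable (fun x => (stencilMean a ^ N) g x ^ 2) μ := hGN.sq.integrable
  have h : ∫ x, (stencilMean a ^ N) (forwardDiff (a k) f) x * (stencilMean a ^ N) g x ∂μ ≤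
      (2 * η)⁻¹ * ∫ x, (stencilMean a ^ N) (forwardDiff (a k) f) x ^ 2 ∂μ +
        η / 2 * ∫ x, (stencilMean a ^ N) g x ^ 2 ∂μ := by
    rw [← integral_const_mul, ← integral_const_mul,
      ← integral_add (hFi.const_mul _) (hGi.const_mul _)]
    refine integral_mono (hF.mul hGN).integrable ((hFi.const_mul _).add (hGi.const_mul _))
      fun x => ?_
    have h2 := sq_nonneg ((stencilMean a ^ N) (forwardDiff (a k) f) x -
      η * (stencilMean a ^ N) g x)
    simp only
    rw [← mul_le_mul_iff_right₀ (by positivity : 0 < 2 * η), mul_add,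
      mul_inv_cancel_left₀ (by positivity)]
    linarith
  have h1 : (2 * η)⁻¹ * ∫ x, (stencilMean a ^ N) (forwardDiff (a k) f) x ^ 2 ∂μ ≤ δ / 2 := by
    rw [inv_mul_le_iff₀ (by positivity)]
    linarith
  have h2 : η / 2 * ∫ x, (stencilMean a ^ N) g x ^ 2 ∂μ ≤ δ / 2 :=
    calc _ ≤ η / 2 * (G + 1) := by
          gcongr
          linarith [integral_stencilMean_pow_sq_le (μ := μ) hg a N]
      _ = δ / 2 := by
          simp only [η]
          field_simp
  linarith

/-- The duality estimate behind the discrete Korn inequality. -/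
theorem exists_integral_forwardDiff_mul_le {p q : ℝ} (hpq : p.HolderConjugate q) :
    ∃ K > 0, ∀ (a : Fin 3 → E) (v : Fin 3 → E → ℝ), (∀ i, IsTestFunction (v i)) →
      ∀ g, IsTestFunction g → ∀ i k : Fin 3,
        ∫ x, forwardDiff (a k) (v i) x * g x ∂μ ≤
          K * (∑ s : Fin 3 × Fin 3, ∫ x, |symDiffQuot a v s.1 s.2 x| ^ p ∂μ +
            ∫ x, |g x| ^ q ∂μ) := by
  obtain ⟨c, B, hB⟩ := exists_isBellman hpq
  have hc := hB.pos
  refine ⟨93312 / c, by positivity, fun a v hv g hg i k => ?_⟩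
  refine le_of_forall_pos_le_add fun δ hδ => ?_
  obtain ⟨N, hN⟩ := exists_integral_stencilMean_pow_mul_le (μ := μ) (hv i) hg a k hδ
  refine (integral_mul_le_sum_add ((hv i).forwardDiff (a k)) hg a N).trans (add_le_add ?_ hN)
  set S := ∑ s : Fin 3 × Fin 3, ∫ x, |symDiffQuot a v s.1 s.2 x| ^ p ∂μ
  set G := ∫ x, |g x| ^ q ∂μ
  have he (s : Fin 3 × Fin 3) : IsTestFunction (symDiffQuot a v s.1 s.2) :=
    IsTestFunction.symDiffQuot hv a s.1 s.2
  have hG : 0 ≤ G := integral_nonneg fun x => by positivity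
  have single (s : Fin 3 × Fin 3) : ∫ x, |symDiffQuot a v s.1 s.2 x| ^ p ∂μ ≤ S :=
    Finset.single_le_sum
      (f := fun s : Fin 3 × Fin 3 => ∫ x, |symDiffQuot a v s.1 s.2 x| ^ p ∂μ)
      (fun _ _ => integral_nonneg fun x => by positivity) (Finset.mem_univ s)
  have step (n : ℕ) (s : Fin 3 × Fin 3) :
      ∫ x, |forwardDiff (a s.1) ((stencilMean a ^ n) (forwardDiff (a k) (v i))) x| *
          |forwardDiff (a s.2) ((stencilMean a ^ n) g) x| ∂μ ≤
        2 * ∑ t : (Fin 3 × Fin 3) × Fin 3,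
          ∫ x, |forwardDiff (a t.2) ((stencilMean a ^ n) (symDiffQuot a v t.1.1 t.1.2)) x| *
            |forwardDiff (a s.2) ((stencilMean a ^ n) g) x| ∂μ := by
    have hgs := ((hg.stencilMean_pow a n).forwardDiff (a s.2)).abs
    have hint (t : (Fin 3 × Fin 3) × Fin 3) := (((((he t.1).stencilMean_pow a n).forwardDiff
      (a t.2)).abs.mul hgs).integrable (μ := μ))
    rw [← integral_finsetSum _ fun t _ => hint t, ← integral_const_mul]
    refine integral_mono (((((hv i).forwardDiff (a k)).stencilMean_pow a n).forwardDiff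
      (a s.1)).abs.mul hgs).integrable
      ((integrable_finsetSum _ fun t _ => hint t).const_mul 2) fun x => ?_
    simp only
    rw [← Finset.sum_mul, ← mul_assoc]
    exact mul_le_mul_of_nonneg_right (abs_forwardDiff_stencilMean_pow_le a v i (s.1) k n x)
      (abs_nonneg _)
  calc _ ≤ ∑ n ∈ Finset.range N, ∑ s : Fin 3 × Fin 3, 2 * ∑ t : (Fin 3 × Fin 3) × Fin 3,
          ∫ x, |forwardDiff (a t.2) ((stencilMean a ^ n) (symDiffQuot a v t.1.1 t.1.2)) x| *
            |forwardDiff (a s.2) ((stencilMean a ^ n) g) x| ∂μ :=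
        Finset.sum_le_sum fun n _ => Finset.sum_le_sum fun s _ => step n s
    _ = ∑ s : Fin 3 × Fin 3, 2 * ∑ t : (Fin 3 × Fin 3) × Fin 3, ∑ n ∈ Finset.range N,
          ∫ x, |forwardDiff (a t.2) ((stencilMean a ^ n) (symDiffQuot a v t.1.1 t.1.2)) x| *
            |forwardDiff (a s.2) ((stencilMean a ^ n) g) x| ∂μ := by
        rw [Finset.sum_comm]
        refine Finset.sum_congr rfl fun s _ => ?_
        rw [← Finset.mul_sum, Finset.sum_comm]
    _ ≤ ∑ _s : Fin 3 × Fin 3, 2 * ∑ _t : (Fin 3 × Fin 3) × Fin 3, 192 / c * (S + G) := by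
        refine Finset.sum_le_sum fun s _ => mul_le_mul_of_nonneg_left
          (Finset.sum_le_sum fun t _ => ?_) zero_le_two
        refine (hB.sum_integral_forwardDiff_le hpq (he t.1) hg a t.2 s.2 N).trans ?_
        gcongr
        exact single t.1
    _ = 93312 / c * (S + G) := by
        simp
        ring

/-- The continuous odd function `t ↦ sign t * |t| ^ r`. -/
noncomputable def signedRpow (r t : ℝ) : ℝ := max t 0 ^ r - max (-t) 0 ^ r

theorem continuous_signedRpow {r : ℝ} (hr : 0 < r) : Continuous (signedRpow r) := by
  refine Continuous.sub ?_ ?_ <;> exact (by fun_prop : Continuous _).rpow_const fun _ => Or.inr hr.le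

theorem signedRpow_zero (r : ℝ) : signedRpow r 0 = 0 := by simp [signedRpow]

theorem signedRpow_of_nonneg {r t : ℝ} (hr : 0 < r) (ht : 0 ≤ t) : signedRpow r t = t ^ r := by
  simp [signedRpow, ht, Real.zero_rpow hr.ne']

theorem signedRpow_of_nonpos {r t : ℝ} (hr : 0 < r) (ht : t ≤ 0) :
    signedRpow r t = -(-t) ^ r := by
  simp [signedRpow, ht, Real.zero_rpow hr.ne']

theorem mul_signedRpow {r : ℝ} (hr : 0 < r) (t : ℝ) : t * signedRpow r t = |t| ^ (r + 1) := by
  rcases le_total 0 t with ht | ht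
  · rw [signedRpow_of_nonneg hr ht, abs_of_nonneg ht,
      Real.rpow_add_one' ht (by positivity), mul_comm]
  · rw [signedRpow_of_nonpos hr ht, abs_of_nonpos ht,
      Real.rpow_add_one' (neg_nonneg.2 ht) (by positivity)]
    ring

theorem abs_signedRpow {r : ℝ} (hr : 0 < r) (t : ℝ) : |signedRpow r t| = |t| ^ r := by
  rcases le_total 0 t with ht | ht
  · rw [signedRpow_of_nonneg hr ht, abs_of_nonneg ht, abs_of_nonneg (Real.rpow_nonneg ht r)]
  · rw [signedRpow_of_nonpos hr ht, abs_of_nonpos ht, abs_neg,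
      abs_of_nonneg (Real.rpow_nonneg (neg_nonneg.2 ht) r)]

/-- The discrete Korn inequality, with a constant independent of the steps `a`. -/
theorem exists_integral_forwardDiff_rpow_le {p : ℝ} (hp : 1 < p) :
    ∃ C > 0, ∀ (a : Fin 3 → E) (v : Fin 3 → E → ℝ), (∀ i, IsTestFunction (v i)) →
      ∀ i k : Fin 3, ∫ x, |forwardDiff (a k) (v i) x| ^ p ∂μ ≤
        C * ∑ s : Fin 3 × Fin 3, ∫ x, |symDiffQuot a v s.1 s.2 x| ^ p ∂μ := by
  have hpq := Real.HolderConjugate.conjExponent hp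
  set q := p.conjExponent
  obtain ⟨K, hK, hle⟩ := exists_integral_forwardDiff_mul_le (μ := μ) hpq
  set l := (2 * K)⁻¹ ^ (q - 1)⁻¹
  have hq1 : 0 < q - 1 := hpq.symm.sub_one_pos
  have hl : 0 < l := Real.rpow_pos_of_pos (by positivity) _
  have hlq : l ^ q = l * (2 * K)⁻¹ := by
    rw [show q = 1 + (q - 1) by ring, Real.rpow_add hl, Real.rpow_one,
      Real.rpow_inv_rpow (by positivity) hq1.ne']
  refine ⟨2 * K / l, by positivity, fun a v hv i k => ?_⟩
  have hF := (hv i).forwardDiff (a k)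
  set F := forwardDiff (a k) (v i)
  have hr : 0 < p - 1 := by linarith
  have hg : IsTestFunction fun x => l * signedRpow (p - 1) (F x) :=
    hF.comp_left (continuous_const.mul (continuous_signedRpow hr)) (by simp [signedRpow_zero])
  have h := hle a v hv _ hg i k
  have h1 : ∫ x, F x * (l * signedRpow (p - 1) (F x)) ∂μ = l * ∫ x, |F x| ^ p ∂μ := by
    rw [← integral_const_mul]
    congr 1
    funext x
    rw [mul_left_comm, mul_signedRpow hr, sub_add_cancel]
  have h2 : ∫ x, |l * signedRpow (p - 1) (F x)| ^ q ∂μ =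
      l * (2 * K)⁻¹ * ∫ x, |F x| ^ p ∂μ := by
    rw [← integral_const_mul, ← hlq]
    congr 1
    funext x
    rw [abs_mul, abs_of_pos hl, abs_signedRpow hr,
      Real.mul_rpow hl.le (Real.rpow_nonneg (abs_nonneg _) _), ← Real.rpow_mul (abs_nonneg _),
      hpq.sub_one_mul_conj]
  rw [h1, h2, mul_add, show K * (l * (2 * K)⁻¹ * ∫ x, |F x| ^ p ∂μ) =
    l * (∫ x, |F x| ^ p ∂μ) / 2 by field_simp] at h
  rw [div_mul_eq_mul_div, le_div_iff₀' hl]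
  linarith

end TestFunctions

section DifferenceQuotients

open Filter Topology

variable {E : Type*} [NormedAddCommGroup E]

theorem IsTestFunction.sum {ι : Type*} {f : ι → E → ℝ} (s : Finset ι)
    (hf : ∀ i, IsTestFunction (f i)) : IsTestFunction fun x => ∑ i ∈ s, f i x where
  continuous := continuous_finsetSum s fun i _ => (hf i).continuous
  hasCompactSupport := by
    classical
    induction s using Finset.induction_on with
    | empty =>
      simp only [Finset.sum_empty]
      exact HasCompactSupport.zero
    | insert i s hi ih =>
      simp only [Finset.sum_insert hi]
      exact (hf i).hasCompactSupport.add ih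

/-- Pointwise convergence of continuous functions dominated by a fixed test function. -/
structure TendstoDominated (F : ℕ → E → ℝ) (G : E → ℝ) : Prop where
  continuous : ∀ n, Continuous (F n)
  bounded : ∃ g, IsTestFunction g ∧ ∀ n x, |F n x| ≤ g x
  tendsto : ∀ x, Tendsto (fun n => F n x) atTop (𝓝 (G x))

namespace TendstoDominated

variable {F F' : ℕ → E → ℝ} {G G' : E → ℝ}

theorem add (h : TendstoDominated F G) (h' : TendstoDominated F' G') :
    TendstoDominated (fun n x => F n x + F' n x) (fun x => G x + G' x) where
  continuous n := (h.continuous n).add (h'.continuous n)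
  bounded := by
    obtain ⟨g, hg, hb⟩ := h.bounded
    obtain ⟨g', hg', hb'⟩ := h'.bounded
    exact ⟨g + g', hg.add hg', fun n x =>
      (abs_add_le _ _).trans (add_le_add (hb n x) (hb' n x))⟩
  tendsto x := (h.tendsto x).add (h'.tendsto x)

theorem integral_abs_rpow [MeasurableSpace E] [BorelSpace E] {μ : Measure E}
    [IsFiniteMeasureOnCompacts μ] (h : TendstoDominated F G) {p : ℝ} (hp : 0 < p) :
    Tendsto (fun n => ∫ x, |F n x| ^ p ∂μ) atTop (𝓝 (∫ x, |G x| ^ p ∂μ)) := by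
  obtain ⟨g, hg, hb⟩ := h.bounded
  have hcont {f : E → ℝ} (hf : Continuous f) : Continuous fun x => |f x| ^ p :=
    hf.abs.rpow_const fun _ => Or.inr hp.le
  refine tendsto_integral_of_dominated_convergence (fun x => |g x| ^ p) (fun n => ?_)
    (hg.abs_rpow hp).integrable (fun n => ae_of_all _ fun x => ?_) (ae_of_all _ fun x => ?_)
  · exact (hcont (h.continuous n)).aestronglyMeasurable
  · rw [Real.norm_of_nonneg (by positivity)]
    exact Real.rpow_le_rpow (abs_nonneg _) ((hb n x).trans (le_abs_self _)) hp.le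
  · exact ((h.tendsto x).abs).rpow_const (Or.inr hp.le)

end TendstoDominated

variable [NormedSpace ℝ E] [ProperSpace E]

theorem tendstoDominated_diffQuot {f : E → ℝ} (hf : ContDiff ℝ 1 f) (hfs : HasCompactSupport f)
    (b : E) : TendstoDominated
      (fun n x => (n + 1 : ℝ) * forwardDiff ((n + 1 : ℝ)⁻¹ • b) f x)
      (fun x => fderiv ℝ f x b) where
  continuous n := continuous_const.mul
    ((IsTestFunction.mk hf.continuous hfs).forwardDiff _).continuous
  bounded := by
    obtain ⟨L, hL⟩ := ContDiff.lipschitzWith_of_hasCompactSupport hfs hf one_ne_zero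
    obtain ⟨R, -, hR⟩ := hfs.exists_pos_le_norm
    refine ⟨fun x => L * ‖b‖ * max 0 (R + ‖b‖ + 1 - ‖x‖), ⟨by fun_prop, ?_⟩, fun n x => ?_⟩
    · refine HasCompactSupport.intro (isCompact_closedBall (0 : E) (R + ‖b‖ + 1)) fun x hx => ?_
      rw [mem_closedBall_zero_iff, not_le] at hx
      simp [hx.le]
    have hn : (0 : ℝ) < n + 1 := by positivity
    have hstep : ‖(n + 1 : ℝ)⁻¹ • b‖ = (n + 1 : ℝ)⁻¹ * ‖b‖ := by
      rw [norm_smul, Real.norm_of_nonneg (by positivity)]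
    rcases le_total (R + ‖b‖) ‖x‖ with hx | hx
    · have hle : ‖(n + 1 : ℝ)⁻¹ • b‖ ≤ ‖b‖ := by
        rw [hstep]
        exact mul_le_of_le_one_left (norm_nonneg b)
          (inv_le_one_of_one_le₀ (by linarith [n.cast_nonneg (α := ℝ)]))
      have hx' := norm_sub_le (x + (n + 1 : ℝ)⁻¹ • b) ((n + 1 : ℝ)⁻¹ • b)
      rw [add_sub_cancel_right] at hx'
      rw [forwardDiff_apply, hR x (by linarith [norm_nonneg b]), hR _ (by linarith)]
      simp only [sub_zero, mul_zero, abs_zero]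
      positivity
    · have hlip := hL.dist_le_mul (x + (n + 1 : ℝ)⁻¹ • b) x
      rw [Real.dist_eq, dist_eq_norm, add_sub_cancel_left, hstep] at hlip
      calc |(n + 1 : ℝ) * forwardDiff ((n + 1 : ℝ)⁻¹ • b) f x|
          ≤ (n + 1) * (L * ((n + 1 : ℝ)⁻¹ * ‖b‖)) := by
            rw [abs_mul, abs_of_pos hn, forwardDiff_apply]
            gcongr
        _ = L * ‖b‖ * 1 := by
            field_simp
        _ ≤ L * ‖b‖ * max 0 (R + ‖b‖ + 1 - ‖x‖) := by
            gcongr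
            exact le_max_of_le_right (by linarith)
  tendsto x := by
    refine ((hf.differentiable one_ne_zero x).hasFDerivAt).lim b
      (c := fun n : ℕ => (n + 1 : ℝ)) ?_
    exact tendsto_norm_atTop_atTop.comp (tendsto_natCast_atTop_atTop.atTop_add tendsto_const_nhds)

/-- Korn's inequality for directional derivatives, with a constant independent of the
directions `b`. -/
theorem exists_integral_fderiv_rpow_le [MeasurableSpace E] [BorelSpace E] (μ : Measure E)
    [IsFiniteMeasureOnCompacts μ] [μ.IsAddRightInvariant] {p : ℝ} (hp : 1 < p) :
    ∃ C > 0, ∀ (b : Fin 3 → E) (v : Fin 3 → E → ℝ), (∀ i, ContDiff ℝ 1 (v i)) →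
      (∀ i, HasCompactSupport (v i)) → ∀ i k : Fin 3,
        ∫ x, |fderiv ℝ (v i) x (b k)| ^ p ∂μ ≤
          C * ∑ s : Fin 3 × Fin 3,
            ∫ x, |fderiv ℝ (v s.1) x (b s.2) + fderiv ℝ (v s.2) x (b s.1)| ^ p ∂μ := by
  obtain ⟨C, hC, hle⟩ := exists_integral_forwardDiff_rpow_le (μ := μ) hp
  have hp0 : 0 < p := by linarith
  refine ⟨C, hC, fun b v hv hvs i k => ?_⟩
  have hD (i j : Fin 3) := tendstoDominated_diffQuot (hv i) (hvs i) (b j)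
  refine le_of_tendsto_of_tendsto ((hD i k).integral_abs_rpow hp0)
    ((tendsto_finsetSum _ fun s _ =>
      ((hD s.1 s.2).add (hD s.2 s.1)).integral_abs_rpow hp0).const_mul C)
    (Eventually.of_forall fun n => ?_)
  have hn : (0 : ℝ) < n + 1 := by positivity
  have scale (F : E → ℝ) : ∫ x, |(n + 1 : ℝ) * F x| ^ p ∂μ =
      (n + 1 : ℝ) ^ p * ∫ x, |F x| ^ p ∂μ := by
    rw [← integral_const_mul]
    congr 1
    funext x
    rw [abs_mul, abs_of_pos hn, Real.mul_rpow hn.le (abs_nonneg _)]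
  have h := hle (fun j => (n + 1 : ℝ)⁻¹ • b j) v (fun i => ⟨(hv i).continuous, hvs i⟩) i k
  simp only [← mul_add, scale, ← Finset.mul_sum]
  rw [mul_left_comm]
  exact mul_le_mul_of_nonneg_left h (by positivity)

end DifferenceQuotients

section Assembly

variable {ε : ℝ} {v : (Fin 3 → ℝ) → (Fin 3 → ℝ)}

theorem Deps_apply_eq_fderiv (hv : ContDiff ℝ 1 v) (x : Fin 3 → ℝ) (i j : Fin 3) :
    Deps ε v x i j =
      fderiv ℝ (fun y => v y i) x (Pi.single j (if j = 2 then ε⁻¹ else 1)) := by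
  rw [fderiv_apply (hv.differentiable one_ne_zero x) i, ContinuousLinearMap.comp_apply,
    ContinuousLinearMap.proj_apply, Deps]
  conv_rhs => rw [← mul_one (if j = 2 then ε⁻¹ else 1), ← smul_eq_mul, Pi.single_smul, map_smul]
  rfl

theorem isTestFunction_Deps (hv : ContDiff ℝ 1 v) (hvs : HasCompactSupport v) (i j : Fin 3) :
    IsTestFunction fun x => Deps ε v x i j := by
  have h : IsTestFunction fun x => fderiv ℝ v x (Pi.single j 1) i :=
    ⟨(continuous_apply i).comp ((hv.continuous_fderiv one_ne_zero).clm_apply continuous_const),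
      (hvs.fderiv_apply ℝ (Pi.single j 1)).comp_left (g := fun w : Fin 3 → ℝ => w i) rfl⟩
  exact h.comp_left (continuous_const_mul _) (mul_zero _)

theorem isTestFunction_symDeps (hv : ContDiff ℝ 1 v) (hvs : HasCompactSupport v) (i j : Fin 3) :
    IsTestFunction fun x => symDeps ε v x i j :=
  ((isTestFunction_Deps hv hvs i j).add (isTestFunction_Deps hv hvs j i)).comp_left
    (continuous_id.div_const 2) (zero_div 2)

theorem IsTestFunction.sum_sq_rpow {A : (Fin 3 → ℝ) → Matrix (Fin 3) (Fin 3) ℝ} {p : ℝ}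
    (hA : ∀ i j, IsTestFunction fun x => A x i j) (hp : 0 < p) :
    IsTestFunction fun x => (∑ i, ∑ j, A x i j ^ 2) ^ p :=
  (IsTestFunction.sum _ fun i => IsTestFunction.sum _ fun j => (hA i j).sq).comp_left
    (Real.continuous_rpow_const hp.le) (Real.zero_rpow hp.ne')

theorem sum_sq_rpow_le (A : Matrix (Fin 3) (Fin 3) ℝ) {p : ℝ} (hp : 0 < p) :
    (∑ i, ∑ j, A i j ^ 2) ^ (p / 2) ≤
      9 ^ (p / 2) * ∑ s : Fin 3 × Fin 3, |A s.1 s.2| ^ p := by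
  obtain ⟨s, -, hs⟩ := Finset.exists_max_image Finset.univ
    (fun s : Fin 3 × Fin 3 => A s.1 s.2 ^ 2) Finset.univ_nonempty
  have hle : ∑ i, ∑ j, A i j ^ 2 ≤ 9 * A s.1 s.2 ^ 2 := by
    rw [← Fintype.sum_prod_type' fun i j => A i j ^ 2]
    simpa using Finset.sum_le_card_nsmul _ _ _ hs
  calc (∑ i, ∑ j, A i j ^ 2) ^ (p / 2) ≤ (9 * A s.1 s.2 ^ 2) ^ (p / 2) := by gcongr
    _ = 9 ^ (p / 2) * |A s.1 s.2| ^ p := by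
        rw [Real.mul_rpow (by norm_num) (sq_nonneg _), sq_rpow_half]
    _ ≤ _ := by
        gcongr
        exact Finset.single_le_sum (f := fun s : Fin 3 × Fin 3 => |A s.1 s.2| ^ p)
          (fun _ _ => by positivity) (Finset.mem_univ s)

theorem abs_rpow_le_sum_sq_rpow (A : Matrix (Fin 3) (Fin 3) ℝ) {p : ℝ} (hp : 0 < p)
    (i j : Fin 3) : |A i j| ^ p ≤ (∑ i, ∑ j, A i j ^ 2) ^ (p / 2) := by
  rw [← sq_rpow_half, ← Fintype.sum_prod_type' fun i j => A i j ^ 2]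
  gcongr
  exact Finset.single_le_sum (f := fun s : Fin 3 × Fin 3 => A s.1 s.2 ^ 2)
    (fun _ _ => sq_nonneg _) (Finset.mem_univ (i, j))

/-- The rescaled Korn inequality for the `q`-th powers of the norms. -/
theorem exists_integral_Deps_le {q : ℝ} (hq : 1 < q) :
    ∃ K > 0, ∀ ε : ℝ, ∀ v : (Fin 3 → ℝ) → (Fin 3 → ℝ), ContDiff ℝ 1 v → HasCompactSupport v →
      ∫ x, (∑ i, ∑ j, Deps ε v x i j ^ 2) ^ (q / 2) ≤
        K * ∫ x, (∑ i, ∑ j, symDeps ε v x i j ^ 2) ^ (q / 2) := by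
  obtain ⟨C, hC, hle⟩ := exists_integral_fderiv_rpow_le (volume : Measure (Fin 3 → ℝ)) hq
  have hq0 : 0 < q := by linarith
  refine ⟨9 ^ (q / 2) * (9 * (C * (9 * 2 ^ q))), by positivity, fun ε v hv hvs => ?_⟩
  set Y := ∫ x, (∑ i, ∑ j, symDeps ε v x i j ^ 2) ^ (q / 2)
  have hint (s : Fin 3 × Fin 3) : Integrable fun x => |Deps ε v x s.1 s.2| ^ q :=
    ((isTestFunction_Deps hv hvs s.1 s.2).abs_rpow hq0).integrable
  have hsym (s : Fin 3 × Fin 3) :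
      ∫ x, |Deps ε v x s.1 s.2 + Deps ε v x s.2 s.1| ^ q ≤ 2 ^ q * Y := by
    have h2 (x : Fin 3 → ℝ) : |Deps ε v x s.1 s.2 + Deps ε v x s.2 s.1| ^ q =
        2 ^ q * |symDeps ε v x s.1 s.2| ^ q := by
      rw [← Real.mul_rpow zero_le_two (abs_nonneg _), ← abs_two, ← abs_mul, symDeps,
        mul_div_cancel₀ _ two_ne_zero]
    simp only [h2]
    rw [integral_const_mul]
    refine mul_le_mul_of_nonneg_left (integral_mono
      ((isTestFunction_symDeps hv hvs s.1 s.2).abs_rpow hq0).integrable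
      (IsTestFunction.sum_sq_rpow (isTestFunction_symDeps hv hvs) (half_pos hq0)).integrable
      fun x => abs_rpow_le_sum_sq_rpow (symDeps ε v x) hq0 s.1 s.2) (by positivity)
  have hgrad (s : Fin 3 × Fin 3) :
      ∫ x, |Deps ε v x s.1 s.2| ^ q ≤ C * (9 * 2 ^ q) * Y := by
    have h := hle (fun j => Pi.single j (if j = 2 then ε⁻¹ else 1)) (fun i x => v x i)
      (fun i => contDiff_pi.1 hv i)
      (fun i => hvs.comp_left (g := fun w : Fin 3 → ℝ => w i) rfl) s.1 s.2
    simp only [← Deps_apply_eq_fderiv hv] at h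
    refine h.trans ?_
    rw [mul_assoc, mul_assoc]
    refine mul_le_mul_of_nonneg_left ?_ hC.le
    simpa using Finset.sum_le_card_nsmul Finset.univ _ _ fun s _ => hsym s
  calc ∫ x, (∑ i, ∑ j, Deps ε v x i j ^ 2) ^ (q / 2)
      ≤ ∫ x, 9 ^ (q / 2) * ∑ s : Fin 3 × Fin 3, |Deps ε v x s.1 s.2| ^ q :=
        integral_mono
          (IsTestFunction.sum_sq_rpow (isTestFunction_Deps hv hvs) (half_pos hq0)).integrable
          ((integrable_finsetSum _ fun s _ => hint s).const_mul _)
          fun x => sum_sq_rpow_le (Deps ε v x) hq0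
    _ = 9 ^ (q / 2) * ∑ s : Fin 3 × Fin 3, ∫ x, |Deps ε v x s.1 s.2| ^ q := by
        rw [integral_const_mul, integral_finsetSum _ fun s _ => hint s]
    _ ≤ 9 ^ (q / 2) * (9 * (C * (9 * 2 ^ q) * Y)) := by
        gcongr
        simpa using Finset.sum_le_card_nsmul Finset.univ _ _ fun s _ => hgrad s
    _ = 9 ^ (q / 2) * (9 * (C * (9 * 2 ^ q))) * Y := by ring

end Assembly

/-- Rescaled Korn inequality: for `1 < q < ∞` there is a constant `C > 0`,
independent of `ε`, such that for all `ε > 0` and all `C¹` compactly supported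
vector fields `v : ℝ³ → ℝ³`, `‖D_ε v‖_{L^q} ≤ C ‖𝔻_ε[v]‖_{L^q}`. -/
theorem rescaled_korn (q : ℝ) (hq : 1 < q) :
    ∃ C > 0, ∀ ε > 0, ∀ v : (Fin 3 → ℝ) → (Fin 3 → ℝ),
      ContDiff ℝ 1 v → HasCompactSupport v →
      (∫ x : Fin 3 → ℝ,
          (∑ i : Fin 3, ∑ j : Fin 3, (Deps ε v x i j) ^ 2) ^ (q / 2)) ^ (1 / q)
        ≤ C * (∫ x : Fin 3 → ℝ,
            (∑ i : Fin 3, ∑ j : Fin 3, (symDeps ε v x i j) ^ 2) ^ (q / 2)) ^ (1 / q) := by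
  obtain ⟨K, hK, hle⟩ := exists_integral_Deps_le hq
  refine ⟨K ^ (1 / q), by positivity, fun ε _ v hv hvs => ?_⟩
  rw [← Real.mul_rpow hK.le (integral_nonneg fun x => by positivity)]
  exact Real.rpow_le_rpow (integral_nonneg fun x => by positivity) (hle ε v hv hvs) (by positivity)
end

section
/- Let 1 ≤ q < ∞, let ε > 0, let ω ⊆ ℝ² be a measurable set, and let u : ℝ² × ℝ → ℝ be continuously differentiable. Then for every x' ∈ ℝ² the map (y', y₃) ↦ û(x', y', y₃) is continuously differentiable with ∂_{y_i} û(x', y', y₃) = ε (∂_{x_i} u)(ε κ(x'/ε) + ε y', y₃) for i = 1,2 and ∂_{y₃} û(x', y', y₃) = (∂_{x₃} u)(ε κ(x'/ε) + ε y', y₃), and consequently ∫_{ω × Y' × (0,1)} |∇_{y'} û|^q dx' dy' dy₃ ≤ ε^q ∫_{ℝ² × (0,1)} |∇_{x'} u|^q dx' dx₃ and ∫_{ω × Y' × (0,1)} |∂_{y₃} û|^q dx' dy' dy₃ ≤ ∫_{ℝ² × (0,1)} |∂_{x₃} u|^q dx' dx₃. -/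
open MeasureTheory

/-- The cell-index map `κ : ℝ² → ℤ²`, `κ(z)_i = ⌊z_i + 1/2⌋`, viewed in `ℝ²`. -/
noncomputable def kappaMap (z : Fin 2 → ℝ) : Fin 2 → ℝ :=
  fun i => (⌊z i + 1 / 2⌋ : ℤ)

/-- The shifted point `ε κ(x'/ε) + ε y' ∈ ℝ²`. -/
noncomputable def shiftPt (ε : ℝ) (x' y' : Fin 2 → ℝ) : Fin 2 → ℝ :=
  fun i => ε * kappaMap (fun j => x' j / ε) i + ε * y' i

/-- The unfolding `û(x', y', y₃) = u(ε κ(x'/ε) + ε y', y₃)` of `u : ℝ² × ℝ → ℝ`. -/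
noncomputable def unfoldOp (ε : ℝ) (u : (Fin 2 → ℝ) × ℝ → ℝ)
    (x' y' : Fin 2 → ℝ) (y3 : ℝ) : ℝ :=
  u (shiftPt ε x' y', y3)

/-- The reference cell `Y' = (-1/2, 1/2)² ⊆ ℝ²`. -/
def Ycell : Set (Fin 2 → ℝ) :=
  Set.univ.pi fun _ => Set.Ioo (-(1 : ℝ) / 2) (1 / 2)

/-- The integer-valued index of the `ε`-cell containing `x`. -/
noncomputable def cellIndex (ε : ℝ) (x : Fin 2 → ℝ) : Fin 2 → ℤ :=
  fun i => ⌊x i / ε + 1 / 2⌋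

/-- The affine map `y ↦ ε k + ε y` sending the reference cell onto the open `ε`-cell with index
`k`. -/
noncomputable def cellMap (ε : ℝ) (k : Fin 2 → ℤ) (y : Fin 2 → ℝ) : Fin 2 → ℝ :=
  fun i => ε * (k i : ℝ) + ε * y i

theorem shiftPt_eq_cellMap (ε : ℝ) (x y : Fin 2 → ℝ) :
    shiftPt ε x y = cellMap ε (cellIndex ε x) y := rfl

theorem measurable_cellIndex (ε : ℝ) : Measurable (cellIndex ε) := by
  refine measurable_pi_lambda _ fun i => ?_
  have h : Measurable fun x : Fin 2 → ℝ => x i / ε + 1 / 2 := by fun_prop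
  exact Int.measurable_floor.comp h

theorem cellIndex_preimage_singleton {ε : ℝ} (hε : 0 < ε) (k : Fin 2 → ℤ) :
    cellIndex ε ⁻¹' {k} =
      Set.univ.pi fun i => Set.Ico (ε * ((k i : ℝ) - 1 / 2)) (ε * ((k i : ℝ) + 1 / 2)) := by
  ext x
  simp only [Set.mem_preimage, Set.mem_singleton_iff, funext_iff, cellIndex, Int.floor_eq_iff,
    Set.mem_univ_pi, Set.mem_Ico]
  refine forall_congr' fun i => ?_
  rw [← le_div_iff₀' hε, ← div_lt_iff₀' hε]
  constructor <;> rintro ⟨h₁, h₂⟩ <;> constructor <;> linarith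

theorem volume_cellIndex_preimage_singleton {ε : ℝ} (hε : 0 < ε) (k : Fin 2 → ℤ) :
    volume (cellIndex ε ⁻¹' {k}) = ENNReal.ofReal (ε ^ 2) := by
  rw [cellIndex_preimage_singleton hε, volume_pi_pi, Fin.prod_univ_two, Real.volume_Ico,
    Real.volume_Ico, ← ENNReal.ofReal_mul (by linarith)]
  congr 1
  ring

theorem hasFDerivAt_cellMap (ε : ℝ) (k : Fin 2 → ℤ) (y : Fin 2 → ℝ) :
    HasFDerivAt (cellMap ε k) (ε • ContinuousLinearMap.id ℝ (Fin 2 → ℝ)) y := by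
  have h := ((hasFDerivAt_id (𝕜 := ℝ) y).const_smul ε).const_add (fun i => ε * (k i : ℝ))
  exact h

theorem contDiff_cellMap (ε : ℝ) (k : Fin 2 → ℤ) : ContDiff ℝ 1 (cellMap ε k) :=
  contDiff_const.add (contDiff_id.const_smul ε)

theorem cellMap_injective {ε : ℝ} (hε : 0 < ε) (k : Fin 2 → ℤ) :
    Function.Injective (cellMap ε k) := by
  intro y z h
  funext i
  have hi := congrFun h i
  simp only [cellMap] at hi
  exact mul_left_cancel₀ hε.ne' (add_left_cancel hi)

theorem measurableSet_Ycell : MeasurableSet Ycell :=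
  MeasurableSet.univ_pi fun _ => measurableSet_Ioo

theorem cellIndex_cellMap {ε : ℝ} (hε : 0 < ε) (k : Fin 2 → ℤ) {y : Fin 2 → ℝ}
    (hy : y ∈ Ycell) : cellIndex ε (cellMap ε k y) = k := by
  funext i
  have hi := hy i (Set.mem_univ i)
  have h : cellMap ε k y i / ε = k i + y i := by
    simp only [cellMap]
    field_simp
  simp only [cellIndex, h, Int.floor_eq_iff]
  constructor <;> linarith [hi.1, hi.2]

theorem pairwise_disjoint_cellMap_image {ε : ℝ} (hε : 0 < ε) :
    Pairwise (Function.onFun Disjoint fun k => cellMap ε k '' Ycell) := by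
  intro k l hkl
  refine Set.disjoint_left.2 ?_
  rintro _ ⟨y, hy, rfl⟩ ⟨z, hz, h⟩
  exact hkl (by rw [← cellIndex_cellMap hε k hy, ← h, cellIndex_cellMap hε l hz])

theorem measurableSet_cellMap_image {ε : ℝ} (hε : 0 < ε) (k : Fin 2 → ℤ) :
    MeasurableSet (cellMap ε k '' Ycell) :=
  measurableSet_Ycell.image_of_measurable_injOn (contDiff_cellMap ε k).continuous.measurable
    (cellMap_injective hε k).injOn

theorem setLIntegral_cellMap_image {ε : ℝ} (hε : 0 < ε) (k : Fin 2 → ℤ)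
    (g : (Fin 2 → ℝ) → ENNReal) :
    ∫⁻ x in cellMap ε k '' Ycell, g x =
      ENNReal.ofReal (ε ^ 2) * ∫⁻ y in Ycell, g (cellMap ε k y) := by
  rw [lintegral_image_eq_lintegral_abs_det_fderiv_mul volume measurableSet_Ycell
    (fun y _ => (hasFDerivAt_cellMap ε k y).hasFDerivWithinAt) (cellMap_injective hε k).injOn,
    ← lintegral_const_mul' _ _ ENNReal.ofReal_ne_top]
  have h : (ε • ContinuousLinearMap.id ℝ (Fin 2 → ℝ)).det = ε ^ 2 := by
    simp [ContinuousLinearMap.det]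
  simp_rw [h, abs_of_pos (pow_pos hε 2)]

/-- Unfolding does not increase the integral of a nonnegative function, measurable or not. -/
theorem lintegral_shiftPt_le {ε : ℝ} (hε : 0 < ε) (ω : Set (Fin 2 → ℝ))
    (g : (Fin 2 → ℝ) → ENNReal) :
    ∫⁻ x in ω, ∫⁻ y in Ycell, g (shiftPt ε x y) ≤ ∫⁻ x, g x := by
  let f : (Fin 2 → ℤ) → ENNReal := fun k => ∫⁻ y in Ycell, g (cellMap ε k y)
  calc ∫⁻ x in ω, ∫⁻ y in Ycell, g (shiftPt ε x y)
      ≤ ∫⁻ x, f (cellIndex ε x) := setLIntegral_le_lintegral _ _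
    _ = ∫⁻ k, f k ∂(volume.map (cellIndex ε)) :=
        (lintegral_map (measurable_of_countable f) (measurable_cellIndex ε)).symm
    _ = ∑' k, f k * ENNReal.ofReal (ε ^ 2) := by
        rw [lintegral_countable']
        refine tsum_congr fun k => ?_
        rw [Measure.map_apply (measurable_cellIndex ε) (measurableSet_singleton k),
          volume_cellIndex_preimage_singleton hε]
    _ = ∑' k, ∫⁻ x in cellMap ε k '' Ycell, g x := by
        refine tsum_congr fun k => ?_
        rw [setLIntegral_cellMap_image hε, mul_comm]
    _ = ∫⁻ x in ⋃ k, cellMap ε k '' Ycell, g x :=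
        (lintegral_iUnion (measurableSet_cellMap_image hε)
          (pairwise_disjoint_cellMap_image hε) g).symm
    _ ≤ ∫⁻ x, g x := setLIntegral_le_lintegral _ _

theorem fderiv_unfoldOp_apply {u : (Fin 2 → ℝ) × ℝ → ℝ} (hu : Differentiable ℝ u) (ε : ℝ)
    (x' y' : Fin 2 → ℝ) (y3 : ℝ) (v : Fin 2 → ℝ) (t : ℝ) :
    fderiv ℝ (fun p : (Fin 2 → ℝ) × ℝ => unfoldOp ε u x' p.1 p.2) (y', y3) (v, t) =
      fderiv ℝ u (shiftPt ε x' y', y3) (ε • v, t) := by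
  have h₁ : HasFDerivAt (fun p : (Fin 2 → ℝ) × ℝ => (cellMap ε (cellIndex ε x') p.1, p.2))
      (((ε • ContinuousLinearMap.id ℝ (Fin 2 → ℝ)).comp
        (ContinuousLinearMap.fst ℝ (Fin 2 → ℝ) ℝ)).prod
        (ContinuousLinearMap.snd ℝ (Fin 2 → ℝ) ℝ)) (y', y3) :=
    (HasFDerivAt.comp (f := Prod.fst) (y', y3) (hasFDerivAt_cellMap ε (cellIndex ε x') y')
      hasFDerivAt_fst).prodMk (hasFDerivAt_snd (p := (y', y3)))
  have h₂ : HasFDerivAt (fun p : (Fin 2 → ℝ) × ℝ => unfoldOp ε u x' p.1 p.2) _ (y', y3) :=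
    HasFDerivAt.comp (y', y3) (hu (cellMap ε (cellIndex ε x') y', y3)).hasFDerivAt h₁
  rw [h₂.fderiv]
  rfl

theorem contDiff_unfoldOp {u : (Fin 2 → ℝ) × ℝ → ℝ} (hu : ContDiff ℝ 1 u) (ε : ℝ)
    (x' : Fin 2 → ℝ) :
    ContDiff ℝ 1 (fun p : (Fin 2 → ℝ) × ℝ => unfoldOp ε u x' p.1 p.2) :=
  hu.comp (((contDiff_cellMap ε (cellIndex ε x')).comp contDiff_fst).prodMk contDiff_snd)

theorem sum_const_mul_sq_rpow {ε : ℝ} (hε : 0 < ε) (q : ℝ) (a : Fin 2 → ℝ) :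
    (∑ i, (ε * a i) ^ 2) ^ (q / 2) = ε ^ q * (∑ i, a i ^ 2) ^ (q / 2) := by
  simp_rw [mul_pow]
  rw [← Finset.mul_sum, Real.mul_rpow (by positivity) (by positivity), ← Real.rpow_natCast,
    ← Real.rpow_mul hε.le]
  congr 2
  push_cast
  ring

/-- For `u` continuously differentiable, the unfolded function
`(y', y₃) ↦ û(x', y', y₃)` is continuously differentiable with
`∂_{y_i} û = ε (∂_{x_i} u)(ε κ(x'/ε) + ε y', y₃)` (`i = 1,2`) and
`∂_{y₃} û = (∂_{x₃} u)(ε κ(x'/ε) + ε y', y₃)`, and consequently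
`∫_{ω × Y' × (0,1)} |∇_{y'} û|^q ≤ ε^q ∫_{ℝ² × (0,1)} |∇_{x'} u|^q` and
`∫_{ω × Y' × (0,1)} |∂_{y₃} û|^q ≤ ∫_{ℝ² × (0,1)} |∂_{x₃} u|^q`. -/
theorem unfolding_gradient_bounds (q : ℝ) (hq : 1 ≤ q) (ε : ℝ) (hε : 0 < ε)
    (ω : Set (Fin 2 → ℝ)) (hω : MeasurableSet ω)
    (u : (Fin 2 → ℝ) × ℝ → ℝ) (hu : ContDiff ℝ 1 u) :
    (∀ x' : Fin 2 → ℝ,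
      ContDiff ℝ 1 (fun p : (Fin 2 → ℝ) × ℝ => unfoldOp ε u x' p.1 p.2) ∧
      (∀ (y' : Fin 2 → ℝ) (y3 : ℝ) (i : Fin 2),
        fderiv ℝ (fun p : (Fin 2 → ℝ) × ℝ => unfoldOp ε u x' p.1 p.2) (y', y3)
            ((Pi.single i 1 : Fin 2 → ℝ), (0 : ℝ))
          = ε * fderiv ℝ u (shiftPt ε x' y', y3)
              ((Pi.single i 1 : Fin 2 → ℝ), (0 : ℝ))) ∧
      (∀ (y' : Fin 2 → ℝ) (y3 : ℝ),
        fderiv ℝ (fun p : (Fin 2 → ℝ) × ℝ => unfoldOp ε u x' p.1 p.2) (y', y3)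
            ((0 : Fin 2 → ℝ), (1 : ℝ))
          = fderiv ℝ u (shiftPt ε x' y', y3) ((0 : Fin 2 → ℝ), (1 : ℝ))))
    ∧
    (∫⁻ x' in ω, ∫⁻ y' in Ycell, ∫⁻ y3 in Set.Ioo (0 : ℝ) 1,
        ENNReal.ofReal ((∑ i : Fin 2,
          (fderiv ℝ (fun p : (Fin 2 → ℝ) × ℝ => unfoldOp ε u x' p.1 p.2) (y', y3)
            ((Pi.single i 1 : Fin 2 → ℝ), (0 : ℝ))) ^ 2) ^ (q / 2))
      ≤ ENNReal.ofReal (ε ^ q) *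
          ∫⁻ x' : Fin 2 → ℝ, ∫⁻ y3 in Set.Ioo (0 : ℝ) 1,
            ENNReal.ofReal ((∑ i : Fin 2,
              (fderiv ℝ u (x', y3) ((Pi.single i 1 : Fin 2 → ℝ), (0 : ℝ))) ^ 2) ^ (q / 2)))
    ∧
    (∫⁻ x' in ω, ∫⁻ y' in Ycell, ∫⁻ y3 in Set.Ioo (0 : ℝ) 1,
        ENNReal.ofReal
          (|fderiv ℝ (fun p : (Fin 2 → ℝ) × ℝ => unfoldOp ε u x' p.1 p.2) (y', y3)
            ((0 : Fin 2 → ℝ), (1 : ℝ))| ^ q)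
      ≤ ∫⁻ x' : Fin 2 → ℝ, ∫⁻ y3 in Set.Ioo (0 : ℝ) 1,
          ENNReal.ofReal (|fderiv ℝ u (x', y3) ((0 : Fin 2 → ℝ), (1 : ℝ))| ^ q)) := by
  have hd : Differentiable ℝ u := hu.differentiable one_ne_zero
  have hfst : ∀ (x' y' : Fin 2 → ℝ) (y3 : ℝ) (i : Fin 2),
      fderiv ℝ (fun p : (Fin 2 → ℝ) × ℝ => unfoldOp ε u x' p.1 p.2) (y', y3)
          ((Pi.single i 1 : Fin 2 → ℝ), (0 : ℝ))
        = ε * fderiv ℝ u (shiftPt ε x' y', y3) ((Pi.single i 1 : Fin 2 → ℝ), (0 : ℝ)) := by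
    intro x' y' y3 i
    rw [fderiv_unfoldOp_apply hd, ← smul_eq_mul, ← map_smul, Prod.smul_mk, smul_zero]
  have hsnd : ∀ (x' y' : Fin 2 → ℝ) (y3 : ℝ),
      fderiv ℝ (fun p : (Fin 2 → ℝ) × ℝ => unfoldOp ε u x' p.1 p.2) (y', y3)
          ((0 : Fin 2 → ℝ), (1 : ℝ))
        = fderiv ℝ u (shiftPt ε x' y', y3) ((0 : Fin 2 → ℝ), (1 : ℝ)) := by
    intro x' y' y3
    rw [fderiv_unfoldOp_apply hd, smul_zero]
  refine ⟨fun x' => ⟨contDiff_unfoldOp hu ε x', hfst x', hsnd x'⟩, ?_, ?_⟩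
  · simp_rw [hfst, sum_const_mul_sq_rpow hε, ENNReal.ofReal_mul (Real.rpow_nonneg hε.le q),
      lintegral_const_mul' _ _ ENNReal.ofReal_ne_top]
    refine mul_le_mul_right ?_ _
    exact lintegral_shiftPt_le hε ω fun x => ∫⁻ y3 in Set.Ioo (0 : ℝ) 1,
      ENNReal.ofReal ((∑ i : Fin 2,
        (fderiv ℝ u (x, y3) ((Pi.single i 1 : Fin 2 → ℝ), (0 : ℝ))) ^ 2) ^ (q / 2))
  · simp_rw [hsnd]
    exact lintegral_shiftPt_le hε ω fun x => ∫⁻ y3 in Set.Ioo (0 : ℝ) 1,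
      ENNReal.ofReal (|fderiv ℝ u (x, y3) ((0 : Fin 2 → ℝ), (1 : ℝ))| ^ q)
end

section
/- The Carreau potential J(ξ) = ((η₀ − η_∞)/(rλ)) (1 + λ‖ξ‖²)^{r/2} + (η_∞/2) ‖ξ‖² is a convex function on E. -/
/-- The Carreau viscosity `η_r(ξ) = (η₀ − η_∞)(1 + λ‖ξ‖²)^{r/2−1} + η_∞`. -/
noncomputable def carreauVisc (r lam eta0 etaInf : ℝ) {E : Type*}
    [NormedAddCommGroup E] [InnerProductSpace ℝ E] (ξ : E) : ℝ :=
  (eta0 - etaInf) * (1 + lam * ‖ξ‖ ^ 2) ^ (r / 2 - 1) + etaInf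

/-- The Carreau stress `S(ξ) = η_r(ξ)·ξ`. -/
noncomputable def carreauStress (r lam eta0 etaInf : ℝ) {E : Type*}
    [NormedAddCommGroup E] [InnerProductSpace ℝ E] (ξ : E) : E :=
  carreauVisc r lam eta0 etaInf ξ • ξ

/-- The Carreau potential `J(ξ) = ((η₀ − η_∞)/(rλ))(1 + λ‖ξ‖²)^{r/2} + (η_∞/2)‖ξ‖²`. -/
noncomputable def carreauPot (r lam eta0 etaInf : ℝ) {E : Type*}
    [NormedAddCommGroup E] [InnerProductSpace ℝ E] (ξ : E) : ℝ :=
  (eta0 - etaInf) / (r * lam) * (1 + lam * ‖ξ‖ ^ 2) ^ (r / 2) + etaInf / 2 * ‖ξ‖ ^ 2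

/-- A nonnegative convex function raised to a real power `p ≥ 1` is convex. -/
theorem ConvexOn.rpow_of_nonneg {E : Type*} [AddCommGroup E] [Module ℝ E] {s : Set E} {f : E → ℝ}
    (hf : ConvexOn ℝ s f) (hf0 : ∀ ⦃x⦄, x ∈ s → 0 ≤ f x) {p : ℝ} (hp : 1 ≤ p) :
    ConvexOn ℝ s (fun x => f x ^ p) := by
  refine ⟨hf.1, fun x hx y hy a b ha hb hab => ?_⟩
  calc f (a • x + b • y) ^ p ≤ (a • f x + b • f y) ^ p :=
        Real.rpow_le_rpow (hf0 (hf.1 hx hy ha hb hab)) (hf.2 hx hy ha hb hab) (by linarith)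
    _ ≤ a • f x ^ p + b • f y ^ p :=
        (convexOn_rpow hp).2 (hf0 hx) (hf0 hy) ha hb hab

/-- `√(1 + c‖x‖²)` is the norm of `(1, √c x)` in the Hilbert sum `ℝ × E`, hence convex. -/
theorem convexOn_sqrt_one_add_mul_norm_sq {E : Type*} [NormedAddCommGroup E]
    [InnerProductSpace ℝ E] {c : ℝ} (hc : 0 ≤ c) :
    ConvexOn ℝ Set.univ (fun x : E => √(1 + c * ‖x‖ ^ 2)) := by
  have key (x : E) : √(1 + c * ‖x‖ ^ 2) = ‖WithLp.toLp 2 ((1 : ℝ), √c • x)‖ := by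
    simp [WithLp.prod_norm_eq_of_L2, norm_smul, mul_pow, Real.sq_sqrt hc]
  simp only [key]
  refine ⟨convex_univ, fun x _ y _ a b ha hb hab => ?_⟩
  have hcomb : WithLp.toLp 2 ((1 : ℝ), √c • (a • x + b • y)) =
      a • WithLp.toLp 2 ((1 : ℝ), √c • x) + b • WithLp.toLp 2 ((1 : ℝ), √c • y) := by
    rw [← WithLp.toLp_smul, ← WithLp.toLp_smul, ← WithLp.toLp_add]
    congr 1
    ext
    · simp [hab]
    · simp [smul_comm √c]
  simp only [hcomb]
  exact convexOn_univ_norm.2 trivial trivial ha hb hab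

/-- The Carreau potential is convex on `E`. -/
theorem carreauPot_convex {E : Type*} [NormedAddCommGroup E] [InnerProductSpace ℝ E]
    [FiniteDimensional ℝ E] (r lam eta0 etaInf : ℝ)
    (hr : 1 < r) (hlam : 0 < lam) (h0 : etaInf < eta0) (hinf : 0 < etaInf) :
    ConvexOn ℝ Set.univ (fun ξ : E => carreauPot r lam eta0 etaInf ξ) := by
  have hnorm : ConvexOn ℝ Set.univ (fun ξ : E => ‖ξ‖ ^ 2) :=
    convexOn_univ_norm.pow (fun _ _ => norm_nonneg _) 2
  have hpow : ConvexOn ℝ Set.univ (fun ξ : E => (1 + lam * ‖ξ‖ ^ 2) ^ (r / 2)) := by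
    refine ((convexOn_sqrt_one_add_mul_norm_sq hlam.le).rpow_of_nonneg
      (fun _ _ => Real.sqrt_nonneg _) hr.le).congr fun ξ _ => ?_
    exact (Real.rpow_div_two_eq_sqrt r (by positivity)).symm
  have hcoef : 0 ≤ (eta0 - etaInf) / (r * lam) :=
    div_nonneg (sub_pos.2 h0).le (by positivity)
  exact (hpow.smul hcoef).add (hnorm.smul (by positivity : 0 ≤ etaInf / 2))
end
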